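/- arXiv:math/0508282 — 2 statements merged into one kernel-verified Lean document; each statement's English description precedes it below -/
import Mathlib

section
/- Under the setting of Theorem 4.1 (c_i = (d₁/d_i)^{j−1+η_**} with η_** as chosen there), an estimator θ̂_φ that is minimax under the loss L_j (i.e., φ differentiable, φ′ ≥ 0, 0 ≤ φ(w) ≤ u₊ = (2/(n+2))(∑_{i=1}^p (d_i/d₁)^{η_**} − 2) for all w, with all risk expectations finite) also dominates X — and is hence minimax — under the loss L_k for every k with j < k < j + η_**. Concretely, for such k one has (2/(n+2)) ( (∑_{i=1}^p d_i^{1−k}/c_i)/(max_i d_i^{1−k}/c_i) − 2 ) = (2/(n+2)) ( ∑_{i=1}^p (d_i/d₁)^{η_**−(k−j)} − 2 ) ≥ u₊, so the sufficient minimaxity bound for L_k is satisfied whenever it is for L_j. -/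
open MeasureTheory Finset Filter

lemma tail_integral_eq_zero {f : ℝ → ℝ} {R t : ℝ} (hfR : ∀ s, R ≤ s → f s = 0) (ht : R ≤ t) :
    ∫ s in t..R, f s = 0 := by
  rw [intervalIntegral.integral_congr (g := fun _ => (0 : ℝ))]
  · simp
  · intro s hs
    rw [Set.uIcc_of_ge ht] at hs
    exact hfR s hs.1

lemma tail_integral_nonneg {f : ℝ → ℝ} {R : ℝ} (hfR : ∀ s, R ≤ s → f s = 0)
    (hf : ∀ s, 0 ≤ f s) (t : ℝ) : 0 ≤ ∫ s in t..R, f s := by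
  rcases le_total R t with h | h
  · rw [tail_integral_eq_zero hfR h]
  · exact intervalIntegral.integral_nonneg h fun s _ => hf s

/-- Integration by parts along a direction `v` against a density `f ∘ Q`, where `f` is continuous
and vanishes beyond `R`; the tail integral of `f` plays the role of the antiderivative. -/
lemma integral_mul_density_mul_lineDeriv {E : Type*} [NormedAddCommGroup E] [NormedSpace ℝ E]
    [MeasurableSpace E] [BorelSpace E] [FiniteDimensional ℝ E] {μ : Measure E}
    [μ.IsAddHaarMeasure] {Q Q' h h' : E → ℝ} {v : E} {f : ℝ → ℝ} {R C : ℝ}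
    (hQ : Continuous Q) (hQ' : Continuous Q') (hQd : ∀ q, HasLineDerivAt ℝ Q (Q' q) q v)
    (hcomp : IsCompact {q | Q q ≤ R}) (hf : Continuous f) (hfR : ∀ t, R ≤ t → f t = 0)
    (hhd : ∀ q, HasLineDerivAt ℝ h (h' q) q v) (hhm : Measurable h) (hhm' : Measurable h')
    (hhC : ∀ q, Q q ≤ R → |h q| ≤ C) (hhC' : ∀ q, Q q ≤ R → |h' q| ≤ C) :
    Integrable (fun q => h q * (f (Q q) * Q' q)) μ ∧
    Integrable (fun q => h' q * ∫ s in Q q..R, f s) μ ∧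
    ∫ q, h q * (f (Q q) * Q' q) ∂μ = ∫ q, h' q * (∫ s in Q q..R, f s) ∂μ := by
  have hKd : ∀ t, HasDerivAt (fun t => ∫ s in t..R, f s) (-f t) t := fun t =>
    intervalIntegral.integral_hasDerivAt_left (hf.intervalIntegrable _ _)
      hf.aestronglyMeasurable.stronglyMeasurableAtFilter hf.continuousAt
  have hKc : Continuous (fun t => ∫ s in t..R, f s) :=
    continuous_iff_continuousAt.2 fun t => (hKd t).continuousAt
  have hKR : ∀ t, R ≤ t → (∫ s in t..R, f s) = 0 := fun t ht => tail_integral_eq_zero hfR ht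
  have key : ∀ {k g : E → ℝ}, Measurable k → Continuous g → (∀ q, Q q ≤ R → |k q| ≤ C) →
      (∀ q, R < Q q → g q = 0) → Integrable (fun q => k q * g q) μ := by
    intro k g hk hg hkC hgR
    have hgs : HasCompactSupport g :=
      HasCompactSupport.of_support_subset_isCompact hcomp fun q hq => by
        by_contra hcon
        exact hq (hgR q (not_le.1 hcon))
    refine ((hg.integrable_of_hasCompactSupport hgs).norm.const_mul C).mono'
      (hk.mul hg.measurable).aestronglyMeasurable (Eventually.of_forall fun q => ?_)
    rw [norm_mul]
    by_cases hq : Q q ≤ R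
    · exact mul_le_mul_of_nonneg_right (hkC q hq) (norm_nonneg _)
    · simp [hgR q (not_le.1 hq)]
  have i1 : Integrable (fun q => h q * (f (Q q) * Q' q)) μ :=
    key hhm ((hf.comp hQ).mul hQ') hhC fun q hq => by simp [hfR _ hq.le]
  have i2 : Integrable (fun q => h' q * ∫ s in Q q..R, f s) μ :=
    key hhm' (hKc.comp hQ) hhC' fun q hq => hKR _ hq.le
  have i3 : Integrable (fun q => h q * ∫ s in Q q..R, f s) μ :=
    key hhm (hKc.comp hQ) hhC fun q hq => hKR _ hq.le
  refine ⟨i1, i2, ?_⟩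
  have ibp := integral_bilinear_hasLineDerivAt_right_eq_neg_left_of_integrable (μ := μ)
    (B := ContinuousLinearMap.mul ℝ ℝ) (f := h) (f' := h') (g := fun q => ∫ s in Q q..R, f s)
    (g' := fun q => -(f (Q q) * Q' q)) (v := v)
    (by simpa using i2) (by simpa using i1.neg) (by simpa using i3) (fun q _ => hhd q)
    (fun q _ => by
      have h1 := (hKd (Q q)).comp_of_eq (0 : ℝ) (hQd q) (by simp)
      exact h1.congr_deriv (neg_mul _ _))
  simp only [ContinuousLinearMap.mul_apply', mul_neg, integral_neg] at ibp
  exact neg_injective ibp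

/-- An integral against `f ∘ Q` which is nonpositive for all continuous compactly supported
`f ≥ 0` is nonpositive for all measurable `f ≥ 0`. -/
lemma integral_mul_comp_nonpos_of_continuous {E : Type*} [TopologicalSpace E]
    [MeasurableSpace E] [BorelSpace E] {μ : Measure E} [IsFiniteMeasureOnCompacts μ]
    {Q Δ : E → ℝ} (hQ : Continuous Q) (hcomp : ∀ R, IsCompact {q | Q q ≤ R})
    (hΔ : Measurable Δ) (hΔb : ∀ R, ∃ C, ∀ q, Q q ≤ R → |Δ q| ≤ C)
    (hcont : ∀ (g : ℝ → ℝ) (R : ℝ), Continuous g → (∀ t, 0 ≤ g t) → (∀ t, R ≤ t → g t = 0) →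
      ∫ q, Δ q * g (Q q) ∂μ ≤ 0)
    {f : ℝ → ℝ} (hf : Measurable f) (hf0 : ∀ t, 0 ≤ f t)
    (hint : Integrable (fun q => Δ q * f (Q q)) μ) :
    ∫ q, Δ q * f (Q q) ∂μ ≤ 0 := by
  set ρ : E → ENNReal := fun q => ENNReal.ofReal |Δ q| with hρ
  have hρm : Measurable ρ := by fun_prop
  have hρr : ∀ q, (ρ q).toReal = |Δ q| := fun q => ENNReal.toReal_ofReal (abs_nonneg _)
  have hρt : ∀ᵐ q ∂μ, ρ q < ⊤ := Eventually.of_forall fun q => ENNReal.ofReal_lt_top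
  set ν : Measure ℝ := Measure.map Q (μ.withDensity ρ) with hν
  have : IsLocallyFiniteMeasure ν := by
    refine ⟨fun t => ⟨Set.Iio (t + 1), Iio_mem_nhds (by linarith), ?_⟩⟩
    obtain ⟨C, hC⟩ := hΔb (t + 1)
    have hle : Q ⁻¹' Set.Iio (t + 1) ⊆ {q | Q q ≤ t + 1} := fun q hq =>
      show Q q ≤ t + 1 from le_of_lt hq
    rw [hν, Measure.map_apply hQ.measurable measurableSet_Iio,
      withDensity_apply _ (hQ.measurable measurableSet_Iio)]
    calc ∫⁻ q in Q ⁻¹' Set.Iio (t + 1), ρ q ∂μ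
        ≤ ∫⁻ _ in Q ⁻¹' Set.Iio (t + 1), ENNReal.ofReal C ∂μ :=
          setLIntegral_mono measurable_const
            fun q hq => ENNReal.ofReal_le_ofReal (hC q (hle hq))
      _ = ENNReal.ofReal C * μ (Q ⁻¹' Set.Iio (t + 1)) := setLIntegral_const _ _
      _ < ⊤ := ENNReal.mul_lt_top ENNReal.ofReal_lt_top
          ((measure_mono hle).trans_lt (hcomp _).measure_lt_top)
  have hiff : ∀ {k : ℝ → ℝ}, Measurable k →
      (Integrable k ν ↔ Integrable (fun q => |Δ q| * k (Q q)) μ) := by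
    intro k hk
    rw [hν, integrable_map_measure hk.aestronglyMeasurable hQ.aemeasurable,
      integrable_withDensity_iff_integrable_smul' hρm hρt]
    simp [hρr]
  have habs : ∀ {k : ℝ → ℝ}, Measurable k → Integrable (fun q => |Δ q| * k (Q q)) μ →
      Integrable (fun q => Δ q * k (Q q)) μ := by
    intro k hk hi
    exact hi.mono (hΔ.mul (hk.comp hQ.measurable)).aestronglyMeasurable
      (Eventually.of_forall fun q => by simp)
  have hfν : Integrable f ν := (hiff hf).2 <|
    hint.mono (hΔ.abs.mul (hf.comp hQ.measurable)).aestronglyMeasurable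
      (Eventually.of_forall fun q => by simp)
  refine le_of_forall_pos_le_add fun ε hε => ?_
  obtain ⟨g, hgs, hgε, hgc, hgi⟩ := hfν.exists_hasCompactSupport_integral_sub_le hε
  obtain ⟨R, hR⟩ : ∃ R, ∀ t, R ≤ t → g t = 0 := by
    obtain ⟨R, hR⟩ := hgs.isCompact.bddAbove
    refine ⟨R + 1, fun t ht => by_contra fun hne => ?_⟩
    have := hR (subset_tsupport g hne)
    linarith
  set gp : ℝ → ℝ := fun t => max (g t) 0 with hgp
  have hgpc : Continuous gp := hgc.max continuous_const
  have hgpi : Integrable gp ν := hgi.pos_part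
  have hgp0 := hcont gp R hgpc (fun t => le_max_right _ _) fun t ht => by simp [hgp, hR t ht]
  have hig := habs hgpc.measurable ((hiff hgpc.measurable).1 hgpi)
  have hdm : Measurable fun t => ‖f t - gp t‖ := (hf.sub hgpc.measurable).norm
  have hdi : Integrable (fun t => ‖f t - gp t‖) ν := (hfν.sub hgpi).norm
  have hdν : ∫ t, ‖f t - gp t‖ ∂ν = ∫ q, |Δ q| * ‖f (Q q) - gp (Q q)‖ ∂μ := by
    rw [hν, integral_map hQ.aemeasurable hdm.aestronglyMeasurable,
      integral_withDensity_eq_integral_toReal_smul hρm hρt]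
    simp [hρr]
  have hdle : ∫ t, ‖f t - gp t‖ ∂ν ≤ ∫ t, ‖f t - g t‖ ∂ν := by
    refine integral_mono hdi (hfν.sub hgi).norm fun t => ?_
    have := abs_max_sub_max_le_abs (f t) (g t) 0
    rwa [max_eq_left (hf0 t)] at this
  have hsub : ∫ q, Δ q * f (Q q) ∂μ - ∫ q, Δ q * gp (Q q) ∂μ
      ≤ ∫ q, |Δ q| * ‖f (Q q) - gp (Q q)‖ ∂μ := by
    rw [← integral_sub hint hig]
    refine integral_mono (hint.sub hig) ((hiff hdm).1 hdi) fun q => ?_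
    calc Δ q * f (Q q) - Δ q * gp (Q q) = Δ q * (f (Q q) - gp (Q q)) := by ring
      _ ≤ |Δ q * (f (Q q) - gp (Q q))| := le_abs_self _
      _ = |Δ q| * ‖f (Q q) - gp (Q q)‖ := by rw [abs_mul, Real.norm_eq_abs]
  linarith

/-- Smoothing from below of a bounded nondecreasing function on `(0, ∞)`: the result is `C¹`-like
on the whole line with bounded derivative and vanishes near `0`. -/
lemma exists_smoothing_below {φ : ℝ → ℝ} {u δ : ℝ} (hδ0 : 0 < δ) (hδ1 : δ < 1)
    (hc : ContinuousOn φ (Set.Ioi 0)) (hm : MonotoneOn φ (Set.Ioi 0))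
    (h0 : ∀ w > (0 : ℝ), 0 ≤ φ w) (hu : ∀ w > (0 : ℝ), φ w ≤ u) :
    ∃ ψ ψ' : ℝ → ℝ, (∀ w, HasDerivAt ψ (ψ' w) w) ∧ (∀ w, 0 ≤ ψ' w) ∧
      (∀ w, ψ' w ≤ u / (δ * δ)) ∧ (∀ w ≤ δ, ψ w = 0) ∧ (∀ w, 0 ≤ ψ w) ∧
      (∀ w > (0 : ℝ), ψ w ≤ φ w) ∧
      ∀ w, δ < (1 - δ) * w → φ ((1 - δ) * w) * (1 - δ / ((1 - δ) * w)) ≤ ψ w := by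
  have hu0 : 0 ≤ u := (h0 1 one_pos).trans (hu 1 one_pos)
  set b : ℝ → ℝ := fun s => if s ≤ δ then 0 else φ s * (1 - δ / s) with hb
  have hbz : ∀ s ≤ δ, b s = 0 := fun s hs => by simp [hb, hs]
  have hbv : ∀ s, δ < s → b s = φ s * (1 - δ / s) := fun s hs => by simp [hb, not_le.2 hs]
  have hfac : ∀ s, δ < s → 0 ≤ 1 - δ / s := fun s hs => by
    rw [sub_nonneg, div_le_one (hδ0.trans hs)]; exact hs.le
  have hbc : Continuous b := by
    refine continuous_if_le continuous_id continuous_const continuousOn_const ?_ ?_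
    · have hsub : {x : ℝ | δ ≤ id x} ⊆ Set.Ioi 0 := fun x hx => lt_of_lt_of_le hδ0 hx
      exact (hc.mono hsub).mul (continuousOn_const.sub
        (continuousOn_const.div continuousOn_id fun x hx => (hsub hx).ne'))
    · intro x hx
      simp [show x = δ from hx, hδ0.ne']
  have hb0 : ∀ s, 0 ≤ b s := fun s => by
    rcases le_or_gt s δ with h | h
    · rw [hbz s h]
    · rw [hbv s h]; exact mul_nonneg (h0 s (hδ0.trans h)) (hfac s h)
  have hbm : Monotone b := by
    intro s t hst
    rcases le_or_gt s δ with h | h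
    · rw [hbz s h]; exact hb0 t
    · have hs := hδ0.trans h
      have ht := hs.trans_le hst
      rw [hbv s h, hbv t (h.trans_le hst)]
      exact mul_le_mul (hm hs ht hst)
        (by have := div_le_div_of_nonneg_left hδ0.le hs hst; linarith) (hfac s h) (h0 t ht)
  have hbφ : ∀ s > (0 : ℝ), b s ≤ φ s := fun s hs => by
    rcases le_or_gt s δ with h | h
    · rw [hbz s h]; exact h0 s hs
    · rw [hbv s h]
      have := div_nonneg hδ0.le hs.le
      nlinarith [h0 s hs]
  set Φ : ℝ → ℝ := fun x => ∫ s in (0 : ℝ)..x, b s with hΦ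
  have hΦd : ∀ x, HasDerivAt Φ (b x) x := fun x => (hbc.integral_hasStrictDerivAt 0 x).hasDerivAt
  have hΦz : ∀ x ≤ δ, Φ x = 0 := by
    intro x hx
    rw [hΦ]
    dsimp only
    rw [intervalIntegral.integral_congr (g := fun _ => (0 : ℝ))]
    · simp
    · intro s hs
      exact hbz s (hs.2.trans (max_le hδ0.le hx))
  have hΦs : ∀ x y, Φ y - Φ x = ∫ s in x..y, b s := fun x y =>
    intervalIntegral.integral_interval_sub_left (hbc.intervalIntegrable _ _)
      (hbc.intervalIntegrable _ _)
  set ψ : ℝ → ℝ := fun w => (Φ w - Φ ((1 - δ) * w)) / (δ * w) with hψ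
  have hψz : ∀ w ≤ δ, ψ w = 0 := by
    intro w hw
    have h2 : (1 - δ) * w ≤ δ := by nlinarith
    simp [hψ, hΦz w hw, hΦz _ h2]
  have hlow : ∀ w > (0 : ℝ), b ((1 - δ) * w) ≤ ψ w := by
    intro w hw
    have hle : (1 - δ) * w ≤ w := by nlinarith
    rw [hψ]
    dsimp only
    rw [le_div_iff₀ (mul_pos hδ0 hw), hΦs]
    have := intervalIntegral.integral_mono_on hle
      (intervalIntegrable_const (c := b ((1 - δ) * w)) (μ := volume))
      (hbc.intervalIntegrable (μ := volume) _ _) fun s hs => hbm hs.1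
    rw [intervalIntegral.integral_const, smul_eq_mul] at this
    linarith
  have hup : ∀ w > (0 : ℝ), ψ w ≤ b w := by
    intro w hw
    have hle : (1 - δ) * w ≤ w := by nlinarith
    rw [hψ]
    dsimp only
    rw [div_le_iff₀ (mul_pos hδ0 hw), hΦs]
    have := intervalIntegral.integral_mono_on hle
      (hbc.intervalIntegrable (μ := volume) _ _)
      (intervalIntegrable_const (c := b w) (μ := volume)) fun s hs => hbm hs.2
    rw [intervalIntegral.integral_const, smul_eq_mul] at this
    linarith
  have hψ0 : ∀ w, 0 ≤ ψ w := fun w => by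
    rcases le_or_gt w 0 with h | h
    · rw [hψz w (h.trans hδ0.le)]
    · exact (hb0 _).trans (hlow w h)
  refine ⟨ψ, fun w => (b w - (1 - δ) * b ((1 - δ) * w) - δ * ψ w) / (δ * w), ?_, ?_, ?_, hψz,
    hψ0, fun w hw => (hup w hw).trans (hbφ w hw), ?_⟩
  · intro w
    rcases eq_or_ne w 0 with rfl | hw
    · have hev : ψ =ᶠ[nhds 0] fun _ => (0 : ℝ) := by
        filter_upwards [Iio_mem_nhds hδ0] with x hx using hψz x (le_of_lt hx)
      simpa using (hasDerivAt_const (0 : ℝ) (0 : ℝ)).congr_of_eventuallyEq hev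
    · have h1 : HasDerivAt (fun w => Φ ((1 - δ) * w)) (b ((1 - δ) * w) * (1 - δ)) w :=
        (hΦd ((1 - δ) * w)).comp w (by simpa using (hasDerivAt_id w).const_mul (1 - δ))
      have h2 : HasDerivAt (fun w : ℝ => δ * w) δ w := by
        simpa using (hasDerivAt_id w).const_mul δ
      have h3 := ((hΦd w).sub h1).div h2 (mul_ne_zero hδ0.ne' hw)
      refine h3.congr_deriv ?_
      rw [hψ]
      simp only [Pi.sub_apply]
      field_simp
  · intro w
    dsimp only
    rcases le_or_gt w δ with h | h
    · have h2 : (1 - δ) * w ≤ δ := by nlinarith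
      simp [hbz w h, hbz _ h2, hψz w h]
    · have hw := hδ0.trans h
      have h3 := hbm (show (1 - δ) * w ≤ w by nlinarith)
      have h4 := hup w hw
      apply div_nonneg _ (mul_pos hδ0 hw).le
      nlinarith
  · intro w
    dsimp only
    rcases le_or_gt w δ with h | h
    · have h2 : (1 - δ) * w ≤ δ := by nlinarith
      simp only [hbz w h, hbz _ h2, hψz w h]
      simp only [mul_zero, sub_zero, zero_div]
      positivity
    · have hw := hδ0.trans h
      have h3 := mul_nonneg (sub_nonneg.2 hδ1.le) (hb0 ((1 - δ) * w))
      have h4 := mul_nonneg hδ0.le (hψ0 w)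
      have h5 := (hbφ w hw).trans (hu w hw)
      exact div_le_div₀ hu0 (by linarith) (by positivity)
        (mul_le_mul_of_nonneg_left h.le hδ0.le)
  · intro w hw
    have hw0 : 0 < w := by
      by_contra hcon
      nlinarith
    rw [← hbv _ hw]
    exact hlow w hw0

/-- The weighted sum of squares `∑ i, x i ^ 2 / a i`. -/
noncomputable def wsq {ι : Type*} [Fintype ι] (a x : ι → ℝ) : ℝ := ∑ i, x i ^ 2 / a i

section WeightedSquares

variable {ι : Type*} [Fintype ι] {a x : ι → ℝ}

lemma wsq_nonneg (ha : ∀ i, 0 < a i) : 0 ≤ wsq a x :=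
  Finset.sum_nonneg fun i _ => div_nonneg (sq_nonneg _) (ha i).le

lemma le_wsq (ha : ∀ i, 0 < a i) (i : ι) : x i ^ 2 / a i ≤ wsq a x :=
  Finset.single_le_sum (f := fun i => x i ^ 2 / a i)
    (fun i _ => div_nonneg (sq_nonneg _) (ha i).le) (Finset.mem_univ i)

lemma eq_zero_of_wsq_eq_zero (ha : ∀ i, 0 < a i) (h : wsq a x = 0) : x = 0 := by
  funext i
  have h1 := le_wsq (x := x) ha i
  rw [h, div_le_iff₀ (ha i), zero_mul] at h1
  exact pow_eq_zero_iff two_ne_zero |>.1 (le_antisymm h1 (sq_nonneg _))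

lemma continuous_wsq : Continuous (wsq a) := by
  unfold wsq
  fun_prop

lemma hasDerivAt_wsq_line [DecidableEq ι] (a x m : ι → ℝ) (i : ι) :
    HasDerivAt (fun t : ℝ => wsq a (x + t • Pi.single i 1 - m)) (2 * (x i - m i) / a i) 0 := by
  have h : ∀ k ∈ (Finset.univ : Finset ι), HasDerivAt
      (fun t : ℝ => ((x + t • (Pi.single i (1 : ℝ) : ι → ℝ) - m) k) ^ 2 / a k)
      (2 * (x k - m k) * (Pi.single i (1 : ℝ) : ι → ℝ) k / a k) 0 := by
    intro k _
    have h1 : HasDerivAt (fun t : ℝ => x k + t * (Pi.single i (1 : ℝ) : ι → ℝ) k - m k)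
        ((Pi.single i (1 : ℝ) : ι → ℝ) k) 0 := by
      simpa using (((hasDerivAt_id (0 : ℝ)).mul_const
        ((Pi.single i (1 : ℝ) : ι → ℝ) k)).const_add (x k)).sub_const (m k)
    simpa using (h1.pow 2).div_const (a k)
  refine (HasDerivAt.fun_sum h).congr_deriv ?_
  rw [Finset.sum_eq_single i]
  · simp
  · intro k _ hk
    simp [Pi.single_eq_of_ne hk]
  · simp

end WeightedSquares

lemma hasDerivAt_id_mul_of_continuousAt {k : ℝ → ℝ} (hk : ContinuousAt k 0) :
    HasDerivAt (fun t => t * k t) (k 0) 0 := by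
  rw [hasDerivAt_iff_tendsto_slope]
  refine (hk.tendsto.mono_left nhdsWithin_le_nhds).congr' ?_
  filter_upwards [self_mem_nhdsWithin] with t ht
  have : t ≠ 0 := ht
  simp [slope_def_field, this]

section Ratio

variable {F F' : ℝ → ℝ} {δ : ℝ}

/-- A differentiable function vanishing near `0` stays differentiable after division by
its argument; the formula is valid at `0` since there both sides are `0`. -/
lemma hasDerivAt_div_self_of_vanish (hδ : 0 < δ) (hF : ∀ w, HasDerivAt F (F' w) w)
    (hz : ∀ w ≤ δ, F w = 0) (w : ℝ) :
    HasDerivAt (fun w => F w / w) ((F' w - F w / w) / w) w := by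
  rcases eq_or_ne w 0 with rfl | hw
  · have hev : (fun w => F w / w) =ᶠ[nhds 0] fun _ => (0 : ℝ) := by
      filter_upwards [Iio_mem_nhds hδ] with x hx
      simp [hz x (le_of_lt hx)]
    simpa using (hasDerivAt_const (0 : ℝ) (0 : ℝ)).congr_of_eventuallyEq hev
  · refine ((hF w).div (hasDerivAt_id w) hw).congr_deriv ?_
    simp only [id]
    field_simp

lemma div_self_le_of_vanish (hδ : 0 < δ) (hz : ∀ w ≤ δ, F w = 0) {u : ℝ} (hu0 : 0 ≤ u)
    (hu : ∀ w, F w ≤ u) {w : ℝ} : F w / w ≤ u / δ := by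
  rcases le_or_gt w δ with h | h
  · rw [hz w h, zero_div]
    positivity
  · exact div_le_div₀ hu0 (hu w) hδ h.le

end Ratio

section Risk

variable {ι κ : Type*} [Fintype ι] [Fintype κ]

/-- The quadratic form in the density. -/
noncomputable def quadForm (d θ : ι → ℝ) (σ : ℝ) (q : (ι → ℝ) × (κ → ℝ)) : ℝ :=
  (wsq d (q.1 - θ) + wsq (fun _ => 1) q.2) / σ ^ 2

/-- The statistic `W`. -/
noncomputable def wStat (a : ι → ℝ) (q : (ι → ℝ) × (κ → ℝ)) : ℝ :=
  wsq a q.1 / wsq (fun _ => 1) q.2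

lemma wStat_nonneg {a : ι → ℝ} (ha : ∀ i, 0 < a i) (q : (ι → ℝ) × (κ → ℝ)) :
    0 ≤ wStat a q :=
  div_nonneg (wsq_nonneg ha) (wsq_nonneg fun _ => one_pos)

lemma measurable_wStat (a : ι → ℝ) : Measurable (wStat (κ := κ) a) :=
  ((continuous_wsq.measurable).comp measurable_fst).div
    ((continuous_wsq.measurable).comp measurable_snd)

lemma continuous_quadForm (d θ : ι → ℝ) (σ : ℝ) : Continuous (quadForm (κ := κ) d θ σ) := by
  unfold quadForm wsq
  fun_prop

lemma isCompact_quadForm_le {d : ι → ℝ} (hd : ∀ i, 0 < d i) (θ : ι → ℝ) {σ : ℝ} (hσ : 0 < σ)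
    (R : ℝ) : IsCompact {q : (ι → ℝ) × (κ → ℝ) | quadForm d θ σ q ≤ R} := by
  set r : ι → ℝ := fun i => R * σ ^ 2 * d i + 1 with hr
  have hsq : ∀ y s : ℝ, y ^ 2 ≤ s → -(s + 1) ≤ y ∧ y ≤ s + 1 := fun y s h =>
    ⟨by nlinarith [sq_nonneg (y + 1)], by nlinarith [sq_nonneg (y - 1)]⟩
  refine (isCompact_Icc (a := ((fun i => θ i - r i, fun _ => -(R * σ ^ 2 + 1)) :
      (ι → ℝ) × (κ → ℝ)))
    (b := (fun i => θ i + r i, fun _ => R * σ ^ 2 + 1))).of_isClosed_subset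
    (isClosed_le (continuous_quadForm d θ σ) continuous_const) ?_
  intro q hq
  have hq : quadForm d θ σ q ≤ R := hq
  rw [quadForm, div_le_iff₀ (by positivity)] at hq
  have hA := wsq_nonneg (x := q.1 - θ) hd
  have hS := wsq_nonneg (a := fun _ : κ => (1 : ℝ)) (x := q.2) fun _ => one_pos
  have h1 : ∀ i, (q.1 i - θ i) ^ 2 ≤ R * σ ^ 2 * d i := fun i => by
    have := le_wsq (x := q.1 - θ) hd i
    rw [div_le_iff₀ (hd i)] at this
    exact this.trans (mul_le_mul_of_nonneg_right (by linarith) (hd i).le)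
  have h2 : ∀ k, (q.2 k) ^ 2 ≤ R * σ ^ 2 := fun k => by
    have := le_wsq (a := fun _ : κ => (1 : ℝ)) (x := q.2) (fun _ => one_pos) k
    rw [div_one] at this
    linarith
  refine ⟨⟨fun i => ?_, fun k => (hsq _ _ (h2 k)).1⟩, ⟨fun i => ?_, fun k => (hsq _ _ (h2 k)).2⟩⟩
  · have := (hsq _ _ (h1 i)).1
    simp only [hr]
    linarith
  · have := (hsq _ _ (h1 i)).2
    simp only [hr]
    linarith

lemma hasLineDerivAt_quadForm_fst [DecidableEq ι] (d θ : ι → ℝ) (σ : ℝ)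
    (q : (ι → ℝ) × (κ → ℝ)) (i : ι) :
    HasLineDerivAt ℝ (quadForm d θ σ) (2 * (q.1 i - θ i) / d i / σ ^ 2) q (Pi.single i 1, 0) := by
  unfold HasLineDerivAt quadForm
  simpa using ((hasDerivAt_wsq_line d q.1 θ i).add_const (wsq (fun _ => 1) q.2)).div_const (σ ^ 2)

lemma hasLineDerivAt_quadForm_snd [DecidableEq κ] (d θ : ι → ℝ) (σ : ℝ)
    (q : (ι → ℝ) × (κ → ℝ)) (k : κ) :
    HasLineDerivAt ℝ (quadForm d θ σ) (2 * q.2 k / σ ^ 2) q (0, Pi.single k 1) := by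
  unfold HasLineDerivAt quadForm
  simpa using ((hasDerivAt_wsq_line (fun _ => 1) q.2 0 k).const_add
    (wsq d (q.1 - θ))).div_const (σ ^ 2)

lemma hasLineDerivAt_fst_mul_comp_wStat [DecidableEq ι] {H H' : ℝ → ℝ}
    (hH : ∀ w, HasDerivAt H (H' w) w) (a : ι → ℝ) (q : (ι → ℝ) × (κ → ℝ)) (i : ι) :
    HasLineDerivAt ℝ (fun q : (ι → ℝ) × (κ → ℝ) => q.1 i * H (wStat a q))
      (H (wStat a q) +
        2 * (H' (wStat a q) * (q.1 i ^ 2 / a i / wsq (fun _ => 1) q.2))) q (Pi.single i 1, 0) := by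
  have h1 : HasDerivAt (fun t : ℝ => wStat a (q + t • ((Pi.single i 1, 0) : (ι → ℝ) × (κ → ℝ))))
      (2 * q.1 i / a i / wsq (fun _ => 1) q.2) 0 := by
    unfold wStat
    simpa using (hasDerivAt_wsq_line a q.1 0 i).div_const (wsq (fun _ => 1) q.2)
  have h2 := (hH (wStat a q)).comp_of_eq (0 : ℝ) h1 (by simp)
  have h3 : HasDerivAt (fun t : ℝ => (q + t • ((Pi.single i 1, 0) : (ι → ℝ) × (κ → ℝ))).1 i)
      1 0 := by
    simpa using (hasDerivAt_id (0 : ℝ)).const_add (q.1 i)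
  refine (h3.mul h2).congr_deriv ?_
  simp only [Function.comp, zero_smul, add_zero]
  ring

lemma hasLineDerivAt_snd_mul_comp_wStat [DecidableEq κ] {G G' : ℝ → ℝ} {a : ι → ℝ} {C : ℝ}
    (ha : ∀ i, 0 < a i) (hG : ∀ w, HasDerivAt G (G' w) w) (hG0 : ∀ w, 0 ≤ w → 0 ≤ G w)
    (hGC : ∀ w, 0 ≤ w → G w ≤ C / w)
    (q : (ι → ℝ) × (κ → ℝ)) (k : κ) :
    HasLineDerivAt ℝ (fun q : (ι → ℝ) × (κ → ℝ) => q.2 k * G (wStat a q))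
      (G (wStat a q) - 2 * (G' (wStat a q) * wStat a q) *
        (q.2 k ^ 2 / wsq (fun _ => 1) q.2)) q (0, Pi.single k 1) := by
  have h3 : HasDerivAt (fun t : ℝ => (q + t • ((0, Pi.single k 1) : (ι → ℝ) × (κ → ℝ))).2 k)
      1 0 := by
    simpa using (hasDerivAt_id (0 : ℝ)).const_add (q.2 k)
  have hS : HasDerivAt (fun t : ℝ => wsq (fun _ => 1) (q.2 + t • Pi.single k (1 : ℝ)))
      (2 * q.2 k) 0 := by
    simpa using hasDerivAt_wsq_line (fun _ => 1) q.2 0 k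
  rcases eq_or_ne (wsq (fun _ => 1) q.2) 0 with hz | hz
  · have hq2 : q.2 = 0 := eq_zero_of_wsq_eq_zero (fun _ => one_pos) hz
    have hA := wsq_nonneg (x := q.1) ha
    have hW0 : wStat a q = 0 := by simp [wStat, hz]
    have hG00 : G 0 = 0 := le_antisymm (by simpa using hGC 0 le_rfl) (hG0 0 le_rfl)
    have hk : ContinuousAt (fun t : ℝ => G (wsq a q.1 / t ^ 2)) 0 := by
      have hnn : ∀ t : ℝ, 0 ≤ wsq a q.1 / t ^ 2 := fun t => div_nonneg hA (sq_nonneg t)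
      unfold ContinuousAt
      simp only [ne_eq, OfNat.ofNat_ne_zero, not_false_eq_true, zero_pow, div_zero, hG00]
      refine squeeze_zero (fun t => hG0 _ (hnn t)) (fun t => hGC _ (hnn t)) ?_
      have hc : Continuous fun t : ℝ => C * t ^ 2 / wsq a q.1 := by fun_prop
      simpa [div_div_eq_mul_div] using hc.tendsto 0
    have h4 := hasDerivAt_id_mul_of_continuousAt hk
    unfold HasLineDerivAt
    refine (h4.congr_deriv (by simp [hW0, hG00])).congr_of_eventuallyEq ?_
    refine Eventually.of_forall fun t => ?_
    have hw : wsq (fun _ => 1) (t • Pi.single k (1 : ℝ)) = t ^ 2 := by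
      rw [wsq, Finset.sum_eq_single k]
      · simp
      · intro l _ hl
        simp [Pi.single_eq_of_ne hl]
      · simp
    simp [wStat, hq2, hw]
  · have h1 : HasDerivAt
        (fun t : ℝ => wStat a (q + t • ((0, Pi.single k 1) : (ι → ℝ) × (κ → ℝ))))
        (-(wsq a q.1 * (2 * q.2 k)) / wsq (fun _ => 1) q.2 ^ 2) 0 := by
      unfold wStat
      simpa using (hasDerivAt_const (0 : ℝ) (wsq a q.1)).fun_div hS (by simpa using hz)
    have h2 := (hG (wStat a q)).comp_of_eq (0 : ℝ) h1 (by simp)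
    refine (h3.mul h2).congr_deriv ?_
    simp only [Function.comp, zero_smul, add_zero, wStat]
    field_simp
    ring

/-- The ratio `∑ e_i x_i² / a_i` over `∑ x_i² / a_i`. -/
noncomputable def wRatio (a e x : ι → ℝ) : ℝ := (∑ i, e i * (x i ^ 2 / a i)) / wsq a x

lemma wRatio_nonneg {a e : ι → ℝ} (ha : ∀ i, 0 < a i) (he : ∀ i, 0 ≤ e i) (x : ι → ℝ) :
    0 ≤ wRatio a e x :=
  div_nonneg (Finset.sum_nonneg fun i _ =>
    mul_nonneg (he i) (div_nonneg (sq_nonneg _) (ha i).le)) (wsq_nonneg ha)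

lemma wRatio_le {a e : ι → ℝ} {M : ℝ} (ha : ∀ i, 0 < a i) (hM : 0 ≤ M) (heM : ∀ i, e i ≤ M)
    (x : ι → ℝ) : wRatio a e x ≤ M := by
  refine div_le_of_le_mul₀ (wsq_nonneg ha) hM ?_
  rw [wsq, Finset.mul_sum]
  exact Finset.sum_le_sum fun i _ =>
    mul_le_mul_of_nonneg_right (heM i) (div_nonneg (sq_nonneg _) (ha i).le)

lemma wRatio_mul_wsq {a e : ι → ℝ} (ha : ∀ i, 0 < a i) (x : ι → ℝ) :
    wRatio a e x * wsq a x = ∑ i, e i * (x i ^ 2 / a i) := by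
  rcases eq_or_ne (wsq a x) 0 with h | h
  · rw [h, mul_zero, eq_zero_of_wsq_eq_zero ha h]
    simp
  · exact div_mul_cancel₀ _ h

lemma measurable_wRatio (a e : ι → ℝ) : Measurable (wRatio a e) := by
  unfold wRatio
  exact (Continuous.measurable (by fun_prop)).div continuous_wsq.measurable

/-- `σ²` times the loss difference between the shrinkage estimator and `X`, arranged for
integration by parts in the coordinates of `X` and of `Z`. -/
noncomputable def riskDiff (d θ a e : ι → ℝ) (ψ : ℝ → ℝ) (q : (ι → ℝ) × (κ → ℝ)) : ℝ :=
  -2 * ∑ i, (q.1 i - θ i) / d i * (e i * (q.1 i * (ψ (wStat a q) / wStat a q))) +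
    wsq (fun _ => 1) q.2 * (ψ (wStat a q) ^ 2 / wStat a q * wRatio a e q.1)

lemma measurable_riskDiff (d θ a e : ι → ℝ) {ψ : ℝ → ℝ} (hψ : Measurable ψ) :
    Measurable (riskDiff (κ := κ) d θ a e ψ) := by
  have hW := measurable_wStat (κ := κ) a
  have hr : Measurable fun q : (ι → ℝ) × (κ → ℝ) => wRatio a e q.1 :=
    (measurable_wRatio a e).comp measurable_fst
  have hS : Measurable fun q : (ι → ℝ) × (κ → ℝ) => wsq (fun _ => 1) q.2 :=
    continuous_wsq.measurable.comp measurable_snd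
  unfold riskDiff
  fun_prop

/-- The divergence-type inequality behind the risk comparison. -/
lemma stein_integrand_nonpos {a e : ι → ℝ} {M u : ℝ} (ha : ∀ i, 0 < a i) (he : ∀ i, 0 ≤ e i)
    (hM : 0 ≤ M) (heM : ∀ i, e i ≤ M)
    (hu : 2 * M + ((Fintype.card κ : ℝ) + 2) / 2 * u * M ≤ ∑ i, e i)
    {ψ ψ' : ℝ → ℝ} (hψ0 : ∀ w, 0 ≤ ψ w) (hψ0' : ∀ w, 0 ≤ ψ' w) (hψu : ∀ w, ψ w ≤ u)
    (q : (ι → ℝ) × (κ → ℝ)) :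
    -(∑ i, e i * (ψ (wStat a q) / wStat a q +
        2 * ((ψ' (wStat a q) - ψ (wStat a q) / wStat a q) / wStat a q *
          (q.1 i ^ 2 / a i / wsq (fun _ => 1) q.2)))) +
      1 / 2 * ∑ k, wRatio a e q.1 * (ψ (wStat a q) ^ 2 / wStat a q -
        2 * ((2 * ψ (wStat a q) * ψ' (wStat a q) - ψ (wStat a q) ^ 2 / wStat a q) / wStat a q *
          wStat a q) * (q.2 k ^ 2 / wsq (fun _ => 1) q.2)) ≤ 0 := by
  set W := wStat a q with hW
  set S := wsq (fun _ => 1) q.2 with hS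
  set b := wRatio a e q.1 with hb
  set H' := (ψ' W - ψ W / W) / W
  set G' := (2 * ψ W * ψ' W - ψ W ^ 2 / W) / W
  have hW0 : 0 ≤ W := wStat_nonneg ha q
  have hb0 : 0 ≤ b := wRatio_nonneg ha he q.1
  have hbM : b ≤ M := wRatio_le ha hM heM q.1
  have e1 : ∑ i, e i * (ψ W / W + 2 * (H' * (q.1 i ^ 2 / a i / S))) =
      (∑ i, e i) * (ψ W / W) + 2 * (H' * W) * b := by
    have h1 : ∑ i, e i * (q.1 i ^ 2 / a i / S) = b * W := by
      rw [hW, wStat, ← mul_div_assoc, hb, wRatio_mul_wsq ha, Finset.sum_div]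
      simp only [mul_div_assoc, hS]
    calc _ = (∑ i, e i) * (ψ W / W) + 2 * H' * ∑ i, e i * (q.1 i ^ 2 / a i / S) := by
          rw [Finset.sum_mul, Finset.mul_sum, ← Finset.sum_add_distrib]
          exact Finset.sum_congr rfl fun i _ => by ring
      _ = _ := by rw [h1]; ring
  have e2 : ∑ k, b * (ψ W ^ 2 / W - 2 * (G' * W) * (q.2 k ^ 2 / S)) =
      b * (Fintype.card κ * (ψ W ^ 2 / W) - 2 * (G' * W) * (S / S)) := by
    have h1 : ∑ k, q.2 k ^ 2 / S = S / S := by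
      rw [← Finset.sum_div]
      simp [hS, wsq]
    rw [← Finset.mul_sum, Finset.sum_sub_distrib, ← Finset.mul_sum, h1]
    simp
  rw [e1, e2]
  rcases hW0.eq_or_lt with h | h
  · simp [← h]
  · have hSS : S / S = 1 := div_self fun h0 => by
      rw [hW, wStat, ← hS, h0, div_zero] at h
      exact lt_irrefl _ h
    have hH' : H' * W = ψ' W - ψ W / W := div_mul_cancel₀ _ h.ne'
    have hG' : G' * W = 2 * ψ W * ψ' W - ψ W ^ 2 / W := div_mul_cancel₀ _ h.ne'
    have hG : ψ W ^ 2 / W = ψ W * (ψ W / W) := by ring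
    rw [hSS, hH', hG', hG]
    have hH0 : 0 ≤ ψ W / W := div_nonneg (hψ0 W) h.le
    have k1 : 0 ≤ ψ' W * b := mul_nonneg (hψ0' W) hb0
    have k2 : 0 ≤ ψ W * (ψ' W * b) := mul_nonneg (hψ0 W) k1
    have k3 : ψ W * b ≤ u * M :=
      mul_le_mul (hψu W) hbM hb0 ((hψ0 W).trans (hψu W))
    have k4 : 2 * b + ((Fintype.card κ : ℝ) + 2) / 2 * (ψ W * b) ≤ ∑ i, e i := by
      have := mul_le_mul_of_nonneg_left k3
        (show (0 : ℝ) ≤ ((Fintype.card κ : ℝ) + 2) / 2 by positivity)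
      linarith
    have k5 := mul_le_mul_of_nonneg_right k4 hH0
    nlinarith

lemma integral_riskDiff_nonpos_of_continuous {d θ a e : ι → ℝ} {σ M u C δ : ℝ}
    (hd : ∀ i, 0 < d i) (hσ : 0 < σ) (ha : ∀ i, 0 < a i) (he : ∀ i, 0 ≤ e i)
    (hM : 0 ≤ M) (heM : ∀ i, e i ≤ M)
    (hu : 2 * M + ((Fintype.card κ : ℝ) + 2) / 2 * u * M ≤ ∑ i, e i)
    {ψ ψ' : ℝ → ℝ} (hδ : 0 < δ) (hψd : ∀ w, HasDerivAt ψ (ψ' w) w) (hψ0 : ∀ w, 0 ≤ ψ w)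
    (hψ0' : ∀ w, 0 ≤ ψ' w) (hψC : ∀ w, ψ' w ≤ C) (hψz : ∀ w ≤ δ, ψ w = 0)
    (hψu : ∀ w, ψ w ≤ u)
    {g : ℝ → ℝ} {R : ℝ} (hg : Continuous g) (hg0 : ∀ t, 0 ≤ g t) (hgR : ∀ t, R ≤ t → g t = 0) :
    ∫ q : (ι → ℝ) × (κ → ℝ), riskDiff d θ a e ψ q * g (quadForm d θ σ q) ≤ 0 := by
  classical
  have hvol : (volume : Measure ((ι → ℝ) × (κ → ℝ))).IsAddHaarMeasure := by
    rw [Measure.volume_eq_prod]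
    exact Measure.prod.instIsAddHaarMeasure _ _
  have hu0 : 0 ≤ u := (hψ0 0).trans (hψu 0)
  have hC0 : 0 ≤ C := (hψ0' 0).trans (hψC 0)
  have hψm : Measurable ψ :=
    (continuous_iff_continuousAt.2 fun w => (hψd w).continuousAt).measurable
  have hψm' : Measurable ψ' := by
    rw [show ψ' = deriv ψ from funext fun w => (hψd w).deriv.symm]
    exact measurable_deriv ψ
  have hWm := measurable_wStat (κ := κ) a
  have hSm : Measurable fun q : (ι → ℝ) × (κ → ℝ) => wsq (fun _ => 1) q.2 :=
    continuous_wsq.measurable.comp measurable_snd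
  have hrm : Measurable fun q : (ι → ℝ) × (κ → ℝ) => wRatio a e q.1 :=
    (measurable_wRatio a e).comp measurable_fst
  have hcomp := isCompact_quadForm_le (κ := κ) hd θ hσ R
  have hb0 : ∀ x, 0 ≤ wRatio a e x := wRatio_nonneg ha he
  have hbM : ∀ x, wRatio a e x ≤ M := wRatio_le ha hM heM
  have hHd := hasDerivAt_div_self_of_vanish hδ hψd hψz
  have hψ2d : ∀ w, HasDerivAt (fun w => ψ w ^ 2) (2 * ψ w * ψ' w) w := fun w => by
    simpa using (hψd w).fun_pow 2
  have hψ2z : ∀ w ≤ δ, ψ w ^ 2 = 0 := fun w hw => by simp [hψz w hw]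
  have hψ2u : ∀ w, ψ w ^ 2 ≤ u ^ 2 := fun w => pow_le_pow_left₀ (hψ0 w) (hψu w) 2
  have hGd := hasDerivAt_div_self_of_vanish hδ hψ2d hψ2z
  have hHle : ∀ w, ψ w / w ≤ u / δ := fun w => div_self_le_of_vanish hδ hψz hu0 hψu
  have hGle : ∀ w, ψ w ^ 2 / w ≤ u ^ 2 / δ := fun w =>
    div_self_le_of_vanish hδ hψ2z (sq_nonneg u) hψ2u
  have hW0 := fun q : (ι → ℝ) × (κ → ℝ) => wStat_nonneg ha q
  have hS0 := fun z : κ → ℝ =>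
    wsq_nonneg (a := fun _ : κ => (1 : ℝ)) (x := z) fun _ => one_pos
  -- integration by parts in the coordinates of `X`
  have hX : ∀ i, _ := fun i =>
    have ⟨C₁, hC₁⟩ := hcomp.exists_bound_of_continuousOn
      (f := fun q : (ι → ℝ) × (κ → ℝ) => q.1 i) (by fun_prop)
    integral_mul_density_mul_lineDeriv (μ := volume)
      (C := max (C₁ * (u / δ)) (u / δ + 2 * (C + u / δ)))
      (continuous_quadForm (κ := κ) d θ σ)
      (show Continuous fun q : (ι → ℝ) × (κ → ℝ) => 2 * (q.1 i - θ i) / d i / σ ^ 2 by fun_prop)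
      (fun q => hasLineDerivAt_quadForm_fst d θ σ q i) hcomp hg hgR
      (fun q => hasLineDerivAt_fst_mul_comp_wStat hHd a q i) (by fun_prop) (by fun_prop)
      (fun q hq => by
        refine le_max_of_le_left ?_
        have hH0 := div_nonneg (hψ0 (wStat a q)) (hW0 q)
        rw [abs_mul, abs_of_nonneg hH0]
        exact mul_le_mul (hC₁ q hq) (hHle _) hH0 ((norm_nonneg _).trans (hC₁ q hq)))
      (fun q hq => by
        refine le_max_of_le_right ?_
        have hH0 := div_nonneg (hψ0 (wStat a q)) (hW0 q)
        set y := q.1 i ^ 2 / a i / wsq (fun _ => 1) q.2 with hy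
        have hy0 : 0 ≤ y := div_nonneg (div_nonneg (sq_nonneg _) (ha i).le) (hS0 _)
        have hyW : y / wStat a q ≤ 1 := div_le_one_of_le₀
          (div_le_div_of_nonneg_right (le_wsq ha i) (hS0 _)) (hW0 q)
        have hyW0 : 0 ≤ y / wStat a q := div_nonneg hy0 (hW0 q)
        have h1 : |ψ' (wStat a q) - ψ (wStat a q) / wStat a q| ≤ C + u / δ := by
          have := hψ0' (wStat a q)
          have := hψC (wStat a q)
          have := hHle (wStat a q)
          rw [abs_le]
          constructor <;> linarith
        have h2 : |(ψ' (wStat a q) - ψ (wStat a q) / wStat a q) / wStat a q * y| ≤ C + u / δ := by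
          rw [div_mul_eq_mul_div, mul_div_assoc, abs_mul, abs_of_nonneg hyW0]
          exact (mul_le_of_le_one_right (abs_nonneg _) hyW).trans h1
        refine (abs_add_le _ _).trans ?_
        rw [abs_of_nonneg hH0, abs_mul, abs_two]
        linarith [hHle (wStat a q)])
  -- integration by parts in the coordinates of `Z`
  have hZ : ∀ k, _ := fun k =>
    have ⟨C₂, hC₂⟩ := hcomp.exists_bound_of_continuousOn
      (f := fun q : (ι → ℝ) × (κ → ℝ) => q.2 k) (by fun_prop)
    integral_mul_density_mul_lineDeriv (μ := volume)
      (h := fun q : (ι → ℝ) × (κ → ℝ) =>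
        wRatio a e q.1 * (q.2 k * (ψ (wStat a q) ^ 2 / wStat a q)))
      (C := max (M * (C₂ * (u ^ 2 / δ))) (M * (u ^ 2 / δ + 2 * (2 * u * C + u ^ 2 / δ))))
      (continuous_quadForm (κ := κ) d θ σ)
      (show Continuous fun q : (ι → ℝ) × (κ → ℝ) => 2 * q.2 k / σ ^ 2 by fun_prop)
      (fun q => hasLineDerivAt_quadForm_snd d θ σ q k) hcomp hg hgR
      (fun q => by
        have h1 := hasLineDerivAt_snd_mul_comp_wStat (C := u ^ 2) ha hGd
          (fun w hw => div_nonneg (sq_nonneg _) hw)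
          (fun w hw => div_le_div_of_nonneg_right (hψ2u w) hw) q k
        have h2 := HasDerivAt.const_mul (wRatio a e q.1) h1
        unfold HasLineDerivAt
        simpa using h2)
      (by fun_prop) (by fun_prop)
      (fun q hq => by
        refine le_max_of_le_left ?_
        have hG0 := div_nonneg (sq_nonneg (ψ (wStat a q))) (hW0 q)
        rw [abs_mul, abs_of_nonneg (hb0 _), abs_mul, abs_of_nonneg hG0]
        exact mul_le_mul (hbM _) (mul_le_mul (hC₂ q hq) (hGle _) hG0
          ((norm_nonneg _).trans (hC₂ q hq))) (by positivity) hM)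
      (fun q hq => by
        refine le_max_of_le_right ?_
        have hG0 := div_nonneg (sq_nonneg (ψ (wStat a q))) (hW0 q)
        rw [abs_mul, abs_of_nonneg (hb0 _)]
        refine mul_le_mul (hbM _) ?_ (abs_nonneg _) hM
        have hy0 : 0 ≤ q.2 k ^ 2 / wsq (fun _ => 1) q.2 := div_nonneg (sq_nonneg _) (hS0 _)
        have hy1 : q.2 k ^ 2 / wsq (fun _ => 1) q.2 ≤ 1 := div_le_one_of_le₀
          (by simpa using le_wsq (a := fun _ : κ => (1 : ℝ)) (x := q.2) (fun _ => one_pos) k)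
          (hS0 _)
        have hp0 := mul_nonneg (hψ0 (wStat a q)) (hψ0' (wStat a q))
        have hp1 := mul_le_mul (hψu (wStat a q)) (hψC (wStat a q)) (hψ0' _) hu0
        have h1 : |2 * ψ (wStat a q) * ψ' (wStat a q) - ψ (wStat a q) ^ 2 / wStat a q|
            ≤ 2 * u * C + u ^ 2 / δ := by
          have := hGle (wStat a q)
          have : 0 ≤ u ^ 2 / δ := by positivity
          rw [abs_le]
          constructor <;> nlinarith
        have h2 : |(2 * ψ (wStat a q) * ψ' (wStat a q) - ψ (wStat a q) ^ 2 / wStat a q) /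
            wStat a q * wStat a q| ≤ 2 * u * C + u ^ 2 / δ := by
          rw [div_mul_eq_mul_div, mul_div_assoc, abs_mul]
          refine (mul_le_of_le_one_right (abs_nonneg _) ?_).trans h1
          rw [abs_of_nonneg (div_nonneg (hW0 q) (hW0 q))]
          exact div_self_le_one _
        refine (abs_sub _ _).trans ?_
        rw [abs_of_nonneg hG0, abs_mul, abs_mul, abs_two, abs_of_nonneg hy0]
        have h3 := mul_le_mul_of_nonneg_left hy1 (abs_nonneg
          ((2 * ψ (wStat a q) * ψ' (wStat a q) - ψ (wStat a q) ^ 2 / wStat a q) /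
            wStat a q * wStat a q))
        linarith [hGle (wStat a q)])
  have hσ2 : σ ^ 2 ≠ 0 := by positivity
  have hsplit : ∀ q : (ι → ℝ) × (κ → ℝ), riskDiff d θ a e ψ q * g (quadForm d θ σ q) =
      (∑ i, (-(σ ^ 2 * e i)) * (q.1 i * (ψ (wStat a q) / wStat a q) *
        (g (quadForm d θ σ q) * (2 * (q.1 i - θ i) / d i / σ ^ 2)))) +
      ∑ k, σ ^ 2 / 2 * (wRatio a e q.1 * (q.2 k * (ψ (wStat a q) ^ 2 / wStat a q)) *
        (g (quadForm d θ σ q) * (2 * q.2 k / σ ^ 2))) := by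
    intro q
    rw [riskDiff, add_mul, wsq, Finset.mul_sum, Finset.sum_mul, Finset.sum_mul, Finset.sum_mul]
    congr 1
    · refine Finset.sum_congr rfl fun i _ => ?_
      field_simp
    · refine Finset.sum_congr rfl fun k _ => ?_
      field_simp
  simp_rw [hsplit]
  rw [integral_add (integrable_finsetSum _ fun i _ => (hX i).1.const_mul _)
    (integrable_finsetSum _ fun k _ => (hZ k).1.const_mul _),
    integral_finsetSum _ fun i _ => (hX i).1.const_mul _,
    integral_finsetSum _ fun k _ => (hZ k).1.const_mul _]
  simp_rw [integral_const_mul, (hX _).2.2, (hZ _).2.2, ← integral_const_mul]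
  rw [← integral_finsetSum _ fun i _ => (hX i).2.1.const_mul _,
    ← integral_finsetSum _ fun k _ => (hZ k).2.1.const_mul _,
    ← integral_add (integrable_finsetSum _ fun i _ => (hX i).2.1.const_mul _)
      (integrable_finsetSum _ fun k _ => (hZ k).2.1.const_mul _)]
  refine integral_nonpos fun q => ?_
  have hpt := stein_integrand_nonpos (κ := κ) ha he hM heM hu hψ0 hψ0' hψu q
  have hK := tail_integral_nonneg hgR hg0 (quadForm d θ σ q)
  refine le_of_eq_of_le ?_ (mul_nonpos_of_nonpos_of_nonneg hpt (mul_nonneg (sq_nonneg σ) hK))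
  rw [add_mul, neg_mul, Finset.sum_mul, mul_assoc (1 / 2 : ℝ), Finset.sum_mul,
    ← Finset.sum_neg_distrib,
    Finset.mul_sum]
  congr 1
  · exact Finset.sum_congr rfl fun i _ => by ring
  · exact Finset.sum_congr rfl fun k _ => by ring

lemma exists_bound_riskDiff {d θ a e : ι → ℝ} {σ M u δ : ℝ}
    (hd : ∀ i, 0 < d i) (hσ : 0 < σ) (ha : ∀ i, 0 < a i) (he : ∀ i, 0 ≤ e i)
    (hM : 0 ≤ M) (heM : ∀ i, e i ≤ M) {ψ : ℝ → ℝ} (hδ : 0 < δ) (hψ0 : ∀ w, 0 ≤ ψ w)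
    (hψz : ∀ w ≤ δ, ψ w = 0) (hψu : ∀ w, ψ w ≤ u) (R : ℝ) :
    ∃ C, ∀ q : (ι → ℝ) × (κ → ℝ), quadForm d θ σ q ≤ R → |riskDiff d θ a e ψ q| ≤ C := by
  have hu0 : 0 ≤ u := (hψ0 0).trans (hψu 0)
  have hψ2z : ∀ w ≤ δ, ψ w ^ 2 = 0 := fun w hw => by simp [hψz w hw]
  have hψ2u : ∀ w, ψ w ^ 2 ≤ u ^ 2 := fun w => pow_le_pow_left₀ (hψ0 w) (hψu w) 2
  have hdom : Continuous fun q : (ι → ℝ) × (κ → ℝ) =>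
      2 * ∑ i, |(q.1 i - θ i) / d i * (e i * q.1 i)| * (u / δ) +
        wsq (fun _ => 1) q.2 * (u ^ 2 / δ * M) := by
    unfold wsq
    fun_prop
  obtain ⟨C, hC⟩ := (isCompact_quadForm_le (κ := κ) hd θ hσ R).exists_bound_of_continuousOn
    hdom.continuousOn
  refine ⟨C, fun q hq => le_trans ?_ ((le_abs_self _).trans (hC q hq))⟩
  have hW0 := wStat_nonneg ha q
  have hS0 := wsq_nonneg (a := fun _ : κ => (1 : ℝ)) (x := q.2) fun _ => one_pos
  have hH0 := div_nonneg (hψ0 (wStat a q)) hW0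
  have hG0 := div_nonneg (sq_nonneg (ψ (wStat a q))) hW0
  have hb0 := wRatio_nonneg ha he q.1
  refine (abs_add_le _ _).trans (add_le_add ?_ ?_)
  · rw [abs_mul, abs_neg, abs_two]
    refine mul_le_mul_of_nonneg_left ((Finset.abs_sum_le_sum_abs _ _).trans
      (Finset.sum_le_sum fun i _ => ?_)) zero_le_two
    rw [← mul_assoc (e i), ← mul_assoc, abs_mul, abs_of_nonneg hH0]
    exact mul_le_mul_of_nonneg_left (div_self_le_of_vanish hδ hψz hu0 hψu) (abs_nonneg _)
  · rw [abs_of_nonneg (mul_nonneg hS0 (mul_nonneg hG0 hb0))]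
    exact mul_le_mul_of_nonneg_left (mul_le_mul
      (div_self_le_of_vanish (F := fun w => ψ w ^ 2) hδ hψ2z (sq_nonneg u) hψ2u)
      (wRatio_le ha hM heM q.1) hb0 (by positivity)) hS0

/-- The weighted squared loss of the shrinkage estimator `(I - (ψ(W)/W) C⁻¹) X`. -/
noncomputable def shrinkLoss (d θ c : ι → ℝ) (k : ℕ) (ψ : ℝ → ℝ) (q : (ι → ℝ) × (κ → ℝ)) : ℝ :=
  ∑ i, ((1 - ψ (wStat (fun i => c i * d i) q) / wStat (fun i => c i * d i) q / c i) * q.1 i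
    - θ i) ^ 2 / d i ^ k

lemma shrinkLoss_sub_eq_riskDiff {d c : ι → ℝ} (hd : ∀ i, 0 < d i) (hc : ∀ i, 0 < c i)
    (θ : ι → ℝ) (k : ℕ) (ψ : ℝ → ℝ) (q : (ι → ℝ) × (κ → ℝ)) :
    shrinkLoss d θ c k ψ q - ∑ i, (q.1 i - θ i) ^ 2 / d i ^ k =
      riskDiff d θ (fun i => c i * d i) (fun i => d i / (d i ^ k * c i)) ψ q := by
  have ha : ∀ i, 0 < c i * d i := fun i => mul_pos (hc i) (hd i)
  unfold shrinkLoss riskDiff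
  set a : ι → ℝ := fun i => c i * d i with hadef
  set W := wStat a q with hW
  set S := wsq (fun _ => 1) q.2 with hS
  set e : ι → ℝ := fun i => d i / (d i ^ k * c i) with hedef
  have h2 : S * (ψ W ^ 2 / W * wRatio a e q.1) =
      ∑ i, (ψ W / W) ^ 2 * (e i * (q.1 i ^ 2 / a i)) := by
    rw [← Finset.mul_sum, ← wRatio_mul_wsq (a := a) ha]
    rcases eq_or_ne W 0 with h | h
    · simp [h]
    · have hne : wsq a q.1 / S ≠ 0 := h
      have hS0 : S ≠ 0 := fun h0 => hne (by rw [h0, div_zero])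
      have hA : wsq a q.1 = W * S := by rw [hW, wStat, ← hS, div_mul_cancel₀ _ hS0]
      rw [hA]
      field_simp
  rw [h2, ← Finset.sum_sub_distrib, Finset.mul_sum, ← Finset.sum_add_distrib]
  refine Finset.sum_congr rfl fun i _ => ?_
  have hdi := (hd i).ne'
  have hci := (hc i).ne'
  simp only [hadef, hedef]
  generalize ψ W / W = r
  field_simp
  ring

/-- Shrinkage dominates `X` when the shrinkage function is bounded by the minimaxity bound. -/
theorem integral_shrinkLoss_le {d c θ : ι → ℝ} {k : ℕ} {σ M u : ℝ} (hd : ∀ i, 0 < d i)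
    (hc : ∀ i, 0 < c i) (hσ : 0 < σ) (hM : 0 ≤ M) (heM : ∀ i, d i / (d i ^ k * c i) ≤ M)
    (hu : 2 * M + ((Fintype.card κ : ℝ) + 2) / 2 * u * M ≤ ∑ i, d i / (d i ^ k * c i))
    {φ : ℝ → ℝ} (hφc : ContinuousOn φ (Set.Ioi 0)) (hφm : MonotoneOn φ (Set.Ioi 0))
    (hφ0 : ∀ w > (0 : ℝ), 0 ≤ φ w) (hφu : ∀ w > (0 : ℝ), φ w ≤ u)
    {f : ℝ → ℝ} (hf : Measurable f) (hf0 : ∀ t, 0 ≤ f t)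
    (hint : Integrable fun q : (ι → ℝ) × (κ → ℝ) =>
      shrinkLoss d θ c k φ q * f (quadForm d θ σ q))
    (hint' : Integrable fun q : (ι → ℝ) × (κ → ℝ) =>
      (∑ i, (q.1 i - θ i) ^ 2 / d i ^ k) * f (quadForm d θ σ q)) :
    ∫ q : (ι → ℝ) × (κ → ℝ), shrinkLoss d θ c k φ q * f (quadForm d θ σ q) ≤
      ∫ q : (ι → ℝ) × (κ → ℝ), (∑ i, (q.1 i - θ i) ^ 2 / d i ^ k) * f (quadForm d θ σ q) := by
  have ha : ∀ i, 0 < c i * d i := fun i => mul_pos (hc i) (hd i)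
  have he : ∀ i, 0 ≤ d i / (d i ^ k * c i) := fun i => by
    have := hd i; have := hc i; positivity
  have hu0 : 0 ≤ u := (hφ0 1 one_pos).trans (hφu 1 one_pos)
  have hfin : IsFiniteMeasureOnCompacts (volume : Measure ((ι → ℝ) × (κ → ℝ))) := by
    rw [Measure.volume_eq_prod]
    have := Measure.prod.instIsAddHaarMeasure (volume : Measure (ι → ℝ)) (volume : Measure (κ → ℝ))
    infer_instance
  set δ : ℕ → ℝ := fun N => 1 / ((N : ℝ) + 2) with hδ
  have hδ0 : ∀ N, 0 < δ N := fun N => by simp only [hδ]; positivity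
  have hδ1 : ∀ N, δ N < 1 := fun N => by
    simp only [hδ]
    rw [div_lt_one (by positivity)]
    have : (0 : ℝ) ≤ N := Nat.cast_nonneg N
    linarith
  have hδl : Tendsto δ atTop (nhds 0) := by
    have h1 := (tendsto_one_div_add_atTop_nhds_zero_nat (𝕜 := ℝ)).comp (tendsto_add_atTop_nat 1)
    refine h1.congr fun N => ?_
    simp only [Function.comp, hδ]
    push_cast
    ring_nf
  choose ψ ψ' hψd hψ0' hψC hψz hψ0 hψφ hψl using fun N =>
    exists_smoothing_below (hδ0 N) (hδ1 N) hφc hφm hφ0 hφu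
  have hψu : ∀ N w, ψ N w ≤ u := fun N w => by
    rcases le_or_gt w 0 with h | h
    · rw [hψz N w (h.trans (hδ0 N).le)]; exact hu0
    · exact (hψφ N w h).trans (hφu w h)
  have hψm : ∀ N, Measurable (ψ N) := fun N =>
    (continuous_iff_continuousAt.2 fun w => (hψd N w).continuousAt).measurable
  have hψt : ∀ w > (0 : ℝ), Tendsto (fun N => ψ N w) atTop (nhds (φ w)) := by
    intro w hw
    have hl : Tendsto (fun N => (1 - δ N) * w) atTop (nhds w) := by
      simpa using ((tendsto_const_nhds (x := (1 : ℝ))).sub hδl).mul_const w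
    have hlow : Tendsto (fun N => φ ((1 - δ N) * w) * (1 - δ N / ((1 - δ N) * w))) atTop
        (nhds (φ w)) := by
      have h1 := ((hφc.continuousAt (Ioi_mem_nhds hw)).tendsto.comp hl).mul
        ((tendsto_const_nhds (x := (1 : ℝ))).sub (hδl.div hl hw.ne'))
      simpa using h1
    have hev : ∀ᶠ N in atTop, δ N < (1 - δ N) * w := hδl.eventually_lt hl hw
    exact tendsto_of_tendsto_of_tendsto_of_le_of_le' hlow tendsto_const_nhds
      (hev.mono fun N hN => hψl N w hN) (Eventually.of_forall fun N => hψφ N w hw)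
  set a : ι → ℝ := fun i => c i * d i with hadef
  have hWm := measurable_wStat (κ := κ) a
  have hQ := continuous_quadForm (κ := κ) d θ σ
  have hsL0 : ∀ ψ (q : (ι → ℝ) × (κ → ℝ)), 0 ≤ shrinkLoss d θ c k ψ q := fun ψ q =>
    Finset.sum_nonneg fun i _ => div_nonneg (sq_nonneg _) (pow_pos (hd i) k).le
  have hsm : ∀ N, Measurable (shrinkLoss (κ := κ) d θ c k (ψ N)) := fun N => by
    have := hψm N
    unfold shrinkLoss
    fun_prop
  have hfm : Measurable fun q : (ι → ℝ) × (κ → ℝ) => f (quadForm d θ σ q) :=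
    hf.comp hQ.measurable
  -- the loss is convex along the segment from `X` to the estimator
  have hbound : ∀ N (q : (ι → ℝ) × (κ → ℝ)), shrinkLoss d θ c k (ψ N) q ≤
      (∑ i, (q.1 i - θ i) ^ 2 / d i ^ k) + shrinkLoss d θ c k φ q := by
    intro N q
    unfold shrinkLoss
    rw [← Finset.sum_add_distrib]
    refine Finset.sum_le_sum fun i _ => ?_
    rw [← add_div]
    refine div_le_div_of_nonneg_right ?_ (pow_pos (hd i) k).le
    have hW0 : 0 ≤ wStat a q := wStat_nonneg ha q
    have hr0 : 0 ≤ ψ N (wStat a q) / wStat a q := div_nonneg (hψ0 N _) hW0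
    have hr1 : ψ N (wStat a q) / wStat a q ≤ φ (wStat a q) / wStat a q := by
      rcases hW0.eq_or_lt with h | h
      · simp [← h]
      · exact div_le_div_of_nonneg_right (hψφ N _ h) h.le
    generalize ψ N (wStat a q) / wStat a q = s at hr0 hr1
    generalize φ (wStat a q) / wStat a q = r at hr1
    have hs : 0 ≤ s / c i := div_nonneg hr0 (hc i).le
    have hsr : s / c i ≤ r / c i := div_le_div_of_nonneg_right hr1 (hc i).le
    generalize s / c i = s at hs hsr
    generalize r / c i = r at hsr
    have key : ∀ y v : ℝ, (y - s * v) ^ 2 ≤ y ^ 2 + (y - r * v) ^ 2 := by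
      intro y v
      rcases le_total (y * v) (s * v ^ 2) with h | h
      · nlinarith [mul_nonneg (sub_nonneg.2 hsr) (sq_nonneg v), sq_nonneg y,
          mul_nonneg (sub_nonneg.2 hsr) (sub_nonneg.2 h),
          mul_nonneg (mul_nonneg (sub_nonneg.2 hsr) (sub_nonneg.2 hsr)) (sq_nonneg v)]
      · nlinarith [mul_nonneg hs (sub_nonneg.2 h), sq_nonneg (y - r * v),
          mul_nonneg (mul_nonneg hs hs) (sq_nonneg v)]
    have := key (q.1 i - θ i) (q.1 i)
    calc ((1 - s) * q.1 i - θ i) ^ 2 = (q.1 i - θ i - s * q.1 i) ^ 2 := by ring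
      _ ≤ _ := this
      _ = _ := by ring
  have hintN : ∀ N, Integrable fun q : (ι → ℝ) × (κ → ℝ) =>
      shrinkLoss d θ c k (ψ N) q * f (quadForm d θ σ q) := by
    intro N
    refine (hint'.add hint).mono' ((hsm N).mul hfm).aestronglyMeasurable
      (Eventually.of_forall fun q => ?_)
    rw [Real.norm_of_nonneg (mul_nonneg (hsL0 _ q) (hf0 _))]
    simp only [Pi.add_apply]
    rw [← add_mul]
    exact mul_le_mul_of_nonneg_right (hbound N q) (hf0 _)
  have hN : ∀ N, ∫ q : (ι → ℝ) × (κ → ℝ), shrinkLoss d θ c k (ψ N) q * f (quadForm d θ σ q) ≤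
      ∫ q : (ι → ℝ) × (κ → ℝ), (∑ i, (q.1 i - θ i) ^ 2 / d i ^ k) * f (quadForm d θ σ q) := by
    intro N
    rw [← sub_nonpos, ← integral_sub (hintN N) hint']
    have hsub := (hintN N).sub hint'
    have heq : ∀ q : (ι → ℝ) × (κ → ℝ),
        shrinkLoss d θ c k (ψ N) q * f (quadForm d θ σ q) -
          (∑ i, (q.1 i - θ i) ^ 2 / d i ^ k) * f (quadForm d θ σ q) =
        riskDiff d θ a (fun i => d i / (d i ^ k * c i)) (ψ N) q * f (quadForm d θ σ q) :=
      fun q => by rw [← sub_mul, shrinkLoss_sub_eq_riskDiff hd hc]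
    rw [integral_congr_ae (Eventually.of_forall heq)]
    exact integral_mul_comp_nonpos_of_continuous hQ (isCompact_quadForm_le hd θ hσ)
      (measurable_riskDiff d θ a _ (hψm N))
      (exists_bound_riskDiff hd hσ ha he hM heM (hδ0 N) (hψ0 N) (hψz N) (hψu N))
      (fun g R hg hg0 hgR => integral_riskDiff_nonpos_of_continuous hd hσ ha he hM heM hu (hδ0 N)
        (hψd N) (hψ0 N) (hψ0' N) (hψC N) (hψz N) (hψu N) hg hg0 hgR)
      hf hf0 (hsub.congr (Eventually.of_forall heq))
  refine le_of_tendsto' (tendsto_integral_of_dominated_convergence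
    (fun q => (∑ i, (q.1 i - θ i) ^ 2 / d i ^ k) * f (quadForm d θ σ q) +
      shrinkLoss d θ c k φ q * f (quadForm d θ σ q))
    (fun N => (hintN N).aestronglyMeasurable) (hint'.add hint)
    (fun N => Eventually.of_forall fun q => ?_) (Eventually.of_forall fun q => ?_)) hN
  · rw [Real.norm_of_nonneg (mul_nonneg (hsL0 _ q) (hf0 _)), ← add_mul]
    exact mul_le_mul_of_nonneg_right (hbound N q) (hf0 _)
  · refine Tendsto.mul_const _ ?_
    unfold shrinkLoss
    have hr : Tendsto (fun N => ψ N (wStat a q) / wStat a q) atTop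
        (nhds (φ (wStat a q) / wStat a q)) := by
      have hW0 : 0 ≤ wStat a q := wStat_nonneg ha q
      rcases hW0.eq_or_lt with h | h
      · simp [← h]
      · exact (hψt _ h).div_const _
    exact tendsto_finsetSum _ fun i _ => (((((hr.div_const (c i)).const_sub 1).mul_const
      (q.1 i)).sub_const (θ i)).pow 2).div_const _

end Risk

/-- Corollary 4.2: under the setting of Theorem 4.1 (`c_i = (d₁/d_i)^{j−1+η_**}`), an
estimator `θ̂_φ` which is minimax under `L_j` (i.e. `φ` differentiable, nondecreasing,
`0 ≤ φ(w) ≤ u₊ = (2/(n+2))(∑ (d_i/d₁)^{η_**} − 2)`) also dominates `X` — hence is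
minimax — under `L_k` for every `k` with `j < k < j + η_**`.  Concretely,
`(2/(n+2))((∑ d_i^{1−k}/c_i)/(max_i d_i^{1−k}/c_i) − 2)
   = (2/(n+2))(∑ (d_i/d₁)^{η_**−(k−j)} − 2) ≥ u₊`. -/
theorem stmt_16
    (p n : ℕ) (hp : 3 ≤ p) (hn : 0 < n) (j : ℕ)
    (d c : Fin p → ℝ)
    (hd_pos : ∀ i, 0 < d i)
    (hd_mono : ∀ i k : Fin p, i ≤ k → d k ≤ d i)
    (hsum : 2 < ∑ i, (d i / d ⟨0, by omega⟩) ^ ((1 : ℝ) - j))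
    (η : ℝ)
    (hη : (d ⟨1, by omega⟩ < d ⟨0, by omega⟩ ∧
        ∃ ηs : ℝ, 0 < ηs ∧ (∑ i, (d i / d ⟨0, by omega⟩) ^ ηs) = 2 ∧
          max 0 (1 - (j : ℝ)) < η ∧ η < ηs) ∨
      (d ⟨1, by omega⟩ = d ⟨0, by omega⟩ ∧ max (1 - (j : ℝ)) 0 < η))
    (hc : ∀ i, c i = (d ⟨0, by omega⟩ / d i) ^ ((j : ℝ) - 1 + η))
    (f : ℝ → ℝ) (hf_nonneg : ∀ t, 0 ≤ f t) (hf_meas : Measurable f)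
    (φ : ℝ → ℝ)
    (hφ_diff : ∀ w > (0:ℝ), DifferentiableAt ℝ φ w)
    (hφ_incr : ∀ w > (0:ℝ), 0 ≤ deriv φ w)
    (hφ_nonneg : ∀ w > (0:ℝ), 0 ≤ φ w)
    (hφ_le : ∀ w > (0:ℝ),
      φ w ≤ 2 / ((n : ℝ) + 2) * ((∑ i, (d i / d ⟨0, by omega⟩) ^ η) - 2))
    -- the new loss index `k`, with `j < k < j + η_**`
    (k : ℕ) (hjk : j < k) (hkη : (k : ℝ) < (j : ℝ) + η)
    (θ : Fin p → ℝ) (σ : ℝ) (hσ : 0 < σ)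
    (dens : ((Fin p → ℝ) × (Fin n → ℝ)) → ℝ)
    (hdens : dens = fun q => (∏ i, (d i) ^ (-(1:ℝ)/2)) * σ ^ (-(p : ℝ) - n) *
      f (((∑ i, (q.1 i - θ i) ^ 2 / d i) + ∑ k', (q.2 k') ^ 2) / σ ^ 2))
    (hnorm : ∫ q, dens q = 1)
    (est : ((Fin p → ℝ) × (Fin n → ℝ)) → Fin p → ℝ)
    (hest : est = fun q i =>
      (1 - φ ((∑ i', (q.1 i') ^ 2 / (c i' * d i')) / (∑ k', (q.2 k') ^ 2)) /
          ((∑ i', (q.1 i') ^ 2 / (c i' * d i')) / (∑ k', (q.2 k') ^ 2)) / c i) * q.1 i)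
    (h_int_est : Integrable (fun q => (∑ i, (est q i - θ i) ^ 2 / d i ^ k) / σ ^ 2 * dens q))
    (h_int_ls : Integrable (fun q => (∑ i, (q.1 i - θ i) ^ 2 / d i ^ k) / σ ^ 2 * dens q)) :
    -- the sufficient minimaxity bound for `L_k` is at least the one for `L_j` …
    (2 / ((n : ℝ) + 2) * ((∑ i, d i ^ ((1 : ℝ) - k) / c i) /
        (univ.sup' (univ_nonempty_iff.mpr ⟨⟨0, by omega⟩⟩)
          (fun i => d i ^ ((1 : ℝ) - k) / c i)) - 2)
      = 2 / ((n : ℝ) + 2) *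
        ((∑ i, (d i / d ⟨0, by omega⟩) ^ (η - ((k : ℝ) - j))) - 2)) ∧
    (2 / ((n : ℝ) + 2) * ((∑ i, (d i / d ⟨0, by omega⟩) ^ η) - 2)
      ≤ 2 / ((n : ℝ) + 2) *
        ((∑ i, (d i / d ⟨0, by omega⟩) ^ (η - ((k : ℝ) - j))) - 2)) ∧
    -- … so `θ̂_φ` also dominates `X` under the loss `L_k`
    (∫ q, (∑ i, (est q i - θ i) ^ 2 / d i ^ k) / σ ^ 2 * dens q ≤
      ∫ q, (∑ i, (q.1 i - θ i) ^ 2 / d i ^ k) / σ ^ 2 * dens q) := by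
  have hd0 : 0 < d ⟨0, by omega⟩ := hd_pos _
  have hle : ∀ i, d i ≤ d ⟨0, by omega⟩ := fun i =>
    hd_mono _ i (Fin.mk_le_of_le_val (Nat.zero_le _))
  generalize hd0' : d ⟨0, by omega⟩ = d₀ at *
  have hx0 : ∀ i, 0 < d i / d₀ := fun i => div_pos (hd_pos i) hd0
  have hx1 : ∀ i, d i / d₀ ≤ 1 := fun i => (div_le_one hd0).2 (hle i)
  have hcpos : ∀ i, 0 < c i := fun i => by
    rw [hc i]
    exact Real.rpow_pos_of_pos (div_pos hd0 (hd_pos i)) _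
  have hjk' : (j : ℝ) < k := by exact_mod_cast hjk
  have hn2 : (0 : ℝ) < (n : ℝ) + 2 := by positivity
  set M : ℝ := d₀ ^ ((1 : ℝ) - k) with hMdef
  have hM : 0 < M := Real.rpow_pos_of_pos hd0 _
  have hterm : ∀ i, d i ^ ((1 : ℝ) - k) / c i = M * (d i / d₀) ^ (η - ((k : ℝ) - j)) := fun i => by
    have hdi : d i = d₀ * (d i / d₀) := by field_simp
    have hinv : c i = (d i / d₀) ^ (-((j : ℝ) - 1 + η)) := by
      rw [hc i, Real.rpow_neg (hx0 i).le, ← Real.inv_rpow (hx0 i).le, inv_div]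
    rw [hinv]
    nth_rewrite 1 [hdi]
    rw [Real.mul_rpow hd0.le (hx0 i).le, mul_div_assoc, ← Real.rpow_sub (hx0 i)]
    congr 2
    ring
  have hterm_le : ∀ i, d i ^ ((1 : ℝ) - k) / c i ≤ M := fun i => by
    rw [hterm i]
    exact mul_le_of_le_one_right hM.le (Real.rpow_le_one (hx0 i).le (hx1 i) (by linarith))
  have hsup : univ.sup' (univ_nonempty_iff.mpr ⟨⟨0, by omega⟩⟩)
      (fun i => d i ^ ((1 : ℝ) - k) / c i) = M := by
    refine le_antisymm (Finset.sup'_le _ _ fun i _ => hterm_le i) ?_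
    refine le_trans (le_of_eq ?_) (Finset.le_sup' (fun i => d i ^ ((1 : ℝ) - k) / c i)
      (mem_univ (⟨0, by omega⟩ : Fin p)))
    simp only [hterm]
    rw [hd0', div_self hd0.ne', Real.one_rpow, mul_one]
  have hsumterm : ∑ i, d i ^ ((1 : ℝ) - k) / c i =
      M * ∑ i, (d i / d₀) ^ (η - ((k : ℝ) - j)) := by
    rw [mul_sum]
    exact sum_congr rfl fun i _ => hterm i
  have hmono : ∑ i, (d i / d₀) ^ η ≤ ∑ i, (d i / d₀) ^ (η - ((k : ℝ) - j)) :=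
    sum_le_sum fun i _ => Real.rpow_le_rpow_of_exponent_ge (hx0 i) (hx1 i) (by linarith)
  refine ⟨by rw [hsup, hsumterm, mul_div_cancel_left₀ _ hM.ne'],
    mul_le_mul_of_nonneg_left (by linarith) (by positivity), ?_⟩
  have hpow : ∀ i, d i / (d i ^ k * c i) = d i ^ ((1 : ℝ) - k) / c i := fun i => by
    rw [Real.rpow_sub (hd_pos i), Real.rpow_one, Real.rpow_natCast, div_div]
  set K : ℝ := (∏ i, (d i) ^ (-(1:ℝ)/2)) * σ ^ (-(p : ℝ) - n) / σ ^ 2 with hK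
  have hK0 : 0 ≤ K := div_nonneg (mul_nonneg
    (prod_nonneg fun i _ => Real.rpow_nonneg (hd_pos i).le _) (Real.rpow_nonneg hσ.le _))
    (sq_nonneg σ)
  have hdens' : ∀ (L : ℝ) (q : (Fin p → ℝ) × (Fin n → ℝ)),
      L / σ ^ 2 * dens q = L * (K * f (quadForm d θ σ q)) := fun L q => by
    simp only [hdens, quadForm, wsq, hK, div_one, Pi.sub_apply]
    ring
  have hest' : ∀ q : (Fin p → ℝ) × (Fin n → ℝ),
      ∑ i, (est q i - θ i) ^ 2 / d i ^ k = shrinkLoss d θ c k φ q := fun q => by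
    simp only [hest, shrinkLoss, wStat, wsq, div_one]
  simp only [hdens', hest'] at h_int_est h_int_ls ⊢
  have hφc : ContinuousOn φ (Set.Ioi 0) := fun w hw =>
    (hφ_diff w hw).continuousAt.continuousWithinAt
  have hφm : MonotoneOn φ (Set.Ioi 0) := by
    refine monotoneOn_of_deriv_nonneg (convex_Ioi 0) hφc ?_ ?_ <;> rw [interior_Ioi]
    exacts [fun w hw => (hφ_diff w hw).differentiableWithinAt, hφ_incr]
  refine integral_shrinkLoss_le (f := fun t => K * f t) hd_pos hcpos hσ hM.le
    (fun i => (hpow i).trans_le (hterm_le i)) ?_ hφc hφm hφ_nonneg hφ_le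
    (hf_meas.const_mul K) (fun t => mul_nonneg hK0 (hf_nonneg t)) h_int_est h_int_ls
  rw [sum_congr rfl fun i _ => hpow i, hsumterm, Fintype.card_fin]
  have hcancel : ((n : ℝ) + 2) / 2 * (2 / ((n : ℝ) + 2) * ((∑ i, (d i / d₀) ^ η) - 2)) =
      (∑ i, (d i / d₀) ^ η) - 2 := by
    field_simp
  rw [hcancel]
  nlinarith [mul_le_mul_of_nonneg_left hmono hM.le]
end

section
/- Under the setting of Theorem 4.1 (p ≥ 3, ∑_{i=1}^p (d_i/d₁)^{1−j} > 2, c_i = (d₁/d_i)^{j−1+η_**} with η_** ∈ (max{0,1−j}, η_*) when d₁ > d₂ and η_** > max{1−j,0} when d₁ = d₂, u₊ = (2/(n+2))(∑_{i=1}^p (d_i/d₁)^{η_**} − 2), v₊ = min_{1≤j'<i≤p} [c_i c_{j'}(d₁ d_{j'} − d_i d_p)/(c_i d₁ d_{j'} − c_{j'} d_i d_p)]), the simple estimator θ̂_SB = (I − (α/(γ(α+1) + W)) C^{-1}) X with constants satisfying 0 < α ≤ u₊ and γ ≥ α/((α+1)v₊) satisfies: (a) R_j(θ̂_SB, θ,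 σ²) ≤ R_j(X, θ, σ²) for all θ ∈ ℝ^p and σ² > 0 (assuming the risk expectations are finite), and (b) for every realized shrinkage factor t = α/(γ(α+1) + W), (max_i d_i(1 − t/c_i))/(min_i d_i(1 − t/c_i)) ≤ d₁/d_p, i.e., θ̂_SB is minimax under L_j and does not increase the condition number relative to the least squares estimator. -/
open MeasureTheory Finset Filter
open scoped ENNReal

/-- The mass that the density `f` puts on `(t, ∞)`. -/
noncomputable def tailMass (f : ℝ → ℝ) (t : ℝ) : ℝ≥0∞ :=
  ∫⁻ τ in Set.Ioi t, ENNReal.ofReal (f τ)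

lemma measurable_tailMass (f : ℝ → ℝ) : Measurable (tailMass f) := by
  apply Antitone.measurable
  intro s t hst
  exact lintegral_mono_set (Set.Ioi_subset_Ioi hst)

lemma image_sq_div_add_Ioi {e : ℝ} (he : 0 < e) (r u : ℝ) :
    (fun s : ℝ => s ^ 2 / e + r) '' Set.Ioi |u| = Set.Ioi (u ^ 2 / e + r) := by
  ext t
  simp only [Set.mem_image, Set.mem_Ioi]
  constructor
  · rintro ⟨s, hs, rfl⟩
    have : u ^ 2 < s ^ 2 := by
      rw [← sq_abs u]
      exact pow_lt_pow_left₀ hs (abs_nonneg u) two_ne_zero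
    gcongr
  · intro ht
    have h0 : u ^ 2 < e * (t - r) := by
      have : u ^ 2 / e < t - r := by linarith
      rwa [div_lt_iff₀ he, mul_comm] at this
    refine ⟨Real.sqrt (e * (t - r)), ?_, ?_⟩
    · apply Real.lt_sqrt_of_sq_lt
      rwa [sq_abs]
    · rw [Real.sq_sqrt (by nlinarith [sq_nonneg u])]
      field_simp
      ring

lemma tailMass_sq_div_add (f : ℝ → ℝ) {e : ℝ} (he : 0 < e) (r u : ℝ) :
    tailMass f (u ^ 2 / e + r) =
      ∫⁻ s in Set.Ioi |u|, ENNReal.ofReal (2 * s / e * f (s ^ 2 / e + r)) := by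
  have hpos : ∀ s ∈ Set.Ioi |u|, 0 < s := fun s hs => (abs_nonneg u).trans_lt hs
  rw [tailMass, ← image_sq_div_add_Ioi he r u,
    lintegral_image_eq_lintegral_abs_deriv_mul (f' := fun s => 2 * s / e) measurableSet_Ioi]
  · refine setLIntegral_congr_fun measurableSet_Ioi fun s hs => ?_
    have hs' : 0 ≤ 2 * s / e := by have := hpos s hs; positivity
    rw [abs_of_nonneg hs', ← ENNReal.ofReal_mul hs']
  · intro s _
    apply HasDerivAt.hasDerivWithinAt
    have := (((hasDerivAt_id s).pow 2).div_const e).add_const r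
    simpa using this
  · intro s hs t ht hst
    have h1 := hpos s hs
    have h2 := hpos t ht
    simp only [add_left_inj] at hst
    rw [div_left_inj' he.ne'] at hst
    exact (pow_left_inj₀ h1.le h2.le two_ne_zero).1 hst

lemma lintegral_mul_tailMass {f : ℝ → ℝ} (hf : Measurable f) {e : ℝ} (he : 0 < e) (r : ℝ)
    {k : ℝ → ℝ≥0∞} (hk : Measurable k) :
    ∫⁻ u, k u * tailMass f (u ^ 2 / e + r) =
      ∫⁻ s in Set.Ioi 0, ENNReal.ofReal (2 * s / e * f (s ^ 2 / e + r)) *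
        ∫⁻ u in Set.Ioc (-s) s, k u := by
  set P : ℝ → ℝ≥0∞ := fun s => ENNReal.ofReal (2 * s / e * f (s ^ 2 / e + r)) with hP
  have hPm : Measurable P := by fun_prop
  let A : Set (ℝ × ℝ) := {q | |q.1| < q.2}
  have hA : MeasurableSet A := measurableSet_lt (by fun_prop) (by fun_prop)
  have h1 : ∀ u, k u * tailMass f (u ^ 2 / e + r) =
      ∫⁻ s, A.indicator (fun q => k q.1 * P q.2) (u, s) := by
    intro u
    rw [tailMass_sq_div_add f he, ← lintegral_const_mul _ hPm,
      ← lintegral_indicator measurableSet_Ioi]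
    congr 1 with s
  have h2 : ∀ s, ∫⁻ u, A.indicator (fun q => k q.1 * P q.2) (u, s) =
      (Set.Ioi 0).indicator (fun s => P s * ∫⁻ u in Set.Ioc (-s) s, k u) s := by
    intro s
    by_cases hs : 0 < s
    · rw [Set.indicator_of_mem (Set.mem_Ioi.2 hs), setLIntegral_congr Ioo_ae_eq_Ioc.symm,
        ← lintegral_const_mul _ hk,
        ← lintegral_indicator measurableSet_Ioo]
      congr 1 with u
      simp only [Set.indicator, A, Set.mem_ofPred_eq, Set.mem_Ioo, abs_lt, mul_comm]
    · rw [Set.indicator_of_notMem (by simpa using hs)]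
      rw [lintegral_eq_zero_iff' (by
        refine Measurable.aemeasurable ?_
        exact (Measurable.indicator (by fun_prop) hA).comp (by fun_prop))]
      refine Eventually.of_forall fun u => ?_
      apply Set.indicator_of_notMem
      simp only [A, Set.mem_ofPred_eq, not_lt]
      exact (not_lt.1 hs).trans (abs_nonneg u)
  simp_rw [h1]
  rw [lintegral_lintegral_swap]
  · simp_rw [h2]
    rw [lintegral_indicator measurableSet_Ioi]
  · exact (Measurable.indicator (by fun_prop) hA).aemeasurable

lemma lintegral_eq_Ioi_add_neg {g : ℝ → ℝ≥0∞} (hg : Measurable g) :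
    ∫⁻ s, g s = ∫⁻ s in Set.Ioi 0, (g s + g (-s)) := by
  rw [lintegral_add_left hg, ← lintegral_add_compl g (measurableSet_Ioi (a := (0 : ℝ))),
    Set.compl_Ioi]
  congr 1
  have := (Measure.measurePreserving_neg (volume : Measure ℝ)).setLIntegral_comp_emb
    (MeasurableEquiv.neg ℝ).measurableEmbedding g (Set.Ioi 0)
  simp only [Set.image_neg_eq_neg, Set.neg_Ioi, neg_zero] at this
  rw [this, setLIntegral_congr Iio_ae_eq_Iic]

lemma lintegral_sq_mul_eq_lintegral_tailMass {f : ℝ → ℝ} (hf : Measurable f) {e : ℝ}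
    (he : 0 < e) (r : ℝ) :
    ∫⁻ s, ENNReal.ofReal (2 * s ^ 2 / e * f (s ^ 2 / e + r)) =
      ∫⁻ u, tailMass f (u ^ 2 / e + r) := by
  have h := lintegral_mul_tailMass hf he r (k := fun _ => 1) measurable_const
  simp only [one_mul, lintegral_const, MeasurableSet.univ, Measure.restrict_apply, Set.univ_inter,
    Real.volume_Ioc] at h
  rw [h, lintegral_eq_Ioi_add_neg (by fun_prop)]
  refine setLIntegral_congr_fun measurableSet_Ioi fun s hs => ?_
  have hs' : 0 ≤ s := le_of_lt hs
  simp only [even_two, Even.neg_pow]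
  rw [← two_mul, mul_comm (ENNReal.ofReal _), ← ENNReal.ofReal_mul (by linarith),
    show (2 : ℝ≥0∞) = ENNReal.ofReal 2 by simp, ← ENNReal.ofReal_mul (by norm_num)]
  congr 1
  ring

lemma integral_eq_Ioi_add_neg {g : ℝ → ℝ} (hg : Integrable g) :
    ∫ s, g s = ∫ s in Set.Ioi 0, (g s + g (-s)) := by
  rw [integral_add hg.integrableOn hg.comp_neg.integrableOn, integral_comp_neg_Ioi, neg_zero,
    add_comm, ← Set.compl_Ioi, add_comm, integral_add_compl measurableSet_Ioi hg]

/-- One-dimensional Stein identity for a monotone function. -/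
lemma stein_of_deriv_nonneg {f : ℝ → ℝ} (hf : Measurable f) (hf0 : ∀ t, 0 ≤ f t) {e : ℝ}
    (he : 0 < e) (r : ℝ) (hT : ∫⁻ u, tailMass f (u ^ 2 / e + r) ≠ ∞)
    {h h' : ℝ → ℝ} (hh : ∀ s, HasDerivAt h (h' s) s) (hh' : ∀ s, 0 ≤ h' s)
    (hint : Integrable fun s => 2 * s / e * f (s ^ 2 / e + r) * h s) :
    ∫ s, 2 * s / e * f (s ^ 2 / e + r) * h s =
      ∫ u, h' u * (tailMass f (u ^ 2 / e + r)).toReal := by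
  have hderiv : h' = deriv h := funext fun s => ((hh s).deriv).symm
  have hm : Measurable h' := hderiv ▸ measurable_deriv h
  have hc : Continuous h := continuous_iff_continuousAt.2 fun s => (hh s).continuousAt
  have hmono : Monotone h := monotone_of_deriv_nonneg (fun s => (hh s).differentiableAt)
    fun s => by rw [(hh s).deriv]; exact hh' s
  have hTm : Measurable fun u => tailMass f (u ^ 2 / e + r) :=
    (measurable_tailMass f).comp (by fun_prop)
  have hfin : ∀ᵐ u, tailMass f (u ^ 2 / e + r) < ∞ := ae_lt_top hTm hT
  rw [integral_eq_Ioi_add_neg hint, integral_eq_lintegral_of_nonneg_ae, 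
    integral_eq_lintegral_of_nonneg_ae]
  · congr 1
    have h1 : ∫⁻ u, ENNReal.ofReal (h' u * (tailMass f (u ^ 2 / e + r)).toReal) =
        ∫⁻ u, ENNReal.ofReal (h' u) * tailMass f (u ^ 2 / e + r) := by
      refine lintegral_congr_ae ?_
      filter_upwards [hfin] with u hu
      rw [ENNReal.ofReal_mul (hh' u), ENNReal.ofReal_toReal hu.ne]
    rw [h1, lintegral_mul_tailMass hf he r hm.ennreal_ofReal]
    refine setLIntegral_congr_fun measurableSet_Ioi fun s hs => ?_
    have hs' : 0 < s := hs
    have hi : IntegrableOn h' (Set.Ioc (-s) s) :=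
      intervalIntegral.integrableOn_deriv_of_nonneg hc.continuousOn (fun x _ => hh x)
        fun x _ => hh' x
    have hle : -s ≤ s := by linarith
    have h2 : ∫⁻ u in Set.Ioc (-s) s, ENNReal.ofReal (h' u) = ENNReal.ofReal (h s - h (-s)) := by
      rw [← ofReal_integral_eq_lintegral_ofReal hi (Eventually.of_forall hh'),
        ← intervalIntegral.integral_of_le hle,
        intervalIntegral.integral_eq_sub_of_hasDerivAt (fun x _ => hh x)
          ((intervalIntegrable_iff_integrableOn_Ioc_of_le hle).2 hi)]
    rw [h2, ← ENNReal.ofReal_mul (mul_nonneg (by positivity) (hf0 _))]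
    congr 1
    rw [neg_sq]
    ring
  · exact Eventually.of_forall fun u => mul_nonneg (hh' u) ENNReal.toReal_nonneg
  · exact (hm.mul hTm.ennreal_toReal).aestronglyMeasurable
  · refine (ae_restrict_iff' measurableSet_Ioi).2 (Eventually.of_forall fun s hs => ?_)
    have hs' : 0 < s := hs
    have h3 : h (-s) ≤ h s := hmono (by linarith)
    have h4 : 2 * s / e * f (s ^ 2 / e + r) * h s + 2 * -s / e * f ((-s) ^ 2 / e + r) * h (-s) =
      2 * s / e * f (s ^ 2 / e + r) * (h s - h (-s)) := by rw [neg_sq]; ring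
    simp only [Pi.zero_apply]
    rw [h4]
    exact mul_nonneg (mul_nonneg (by positivity) (hf0 _)) (by linarith)
  · exact (hint.add hint.comp_neg).aestronglyMeasurable.restrict

lemma integrable_sq_mul_of_tailMass {f : ℝ → ℝ} (hf : Measurable f) (hf0 : ∀ t, 0 ≤ f t) {e : ℝ}
    (he : 0 < e) (r : ℝ) (hT : ∫⁻ u, tailMass f (u ^ 2 / e + r) ≠ ∞) :
    Integrable fun s => 2 * s ^ 2 / e * f (s ^ 2 / e + r) := by
  refine ⟨by fun_prop, ?_⟩
  rw [hasFiniteIntegral_iff_ofReal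
    (Eventually.of_forall fun s => mul_nonneg (by positivity) (hf0 _)),
    lintegral_sq_mul_eq_lintegral_tailMass hf he]
  exact hT.lt_top

/-- One-dimensional Stein identity for a function with bounded derivative. -/
lemma stein_of_deriv_bounded {f : ℝ → ℝ} (hf : Measurable f) (hf0 : ∀ t, 0 ≤ f t) {e : ℝ}
    (he : 0 < e) (r : ℝ) (hT : ∫⁻ u, tailMass f (u ^ 2 / e + r) ≠ ∞)
    {h h' : ℝ → ℝ} (hh : ∀ s, HasDerivAt h (h' s) s) {M : ℝ} (hM : ∀ s, |h' s| ≤ M)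
    (hint : Integrable fun s => 2 * s / e * f (s ^ 2 / e + r) * h s) :
    ∫ s, 2 * s / e * f (s ^ 2 / e + r) * h s =
      ∫ u, h' u * (tailMass f (u ^ 2 / e + r)).toReal := by
  have hM0 : 0 ≤ M := (abs_nonneg _).trans (hM 0)
  have hlin : ∀ s : ℝ, HasDerivAt (fun s => M * s) M s := fun s => by
    simpa using (hasDerivAt_id s).const_mul M
  have hint2 : Integrable fun s => 2 * s / e * f (s ^ 2 / e + r) * (M * s) := by
    refine ((integrable_sq_mul_of_tailMass hf hf0 he r hT).const_mul M).congr
      (Eventually.of_forall fun s => ?_)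
    simp only
    ring
  have h1 := stein_of_deriv_nonneg hf hf0 he r hT hlin (fun _ => hM0) hint2
  have h2 := stein_of_deriv_nonneg hf hf0 he r hT (fun s => (hh s).add (hlin s))
    (fun s => by have := neg_abs_le (h' s); have := hM s; linarith)
    ((hint.add hint2).congr (Eventually.of_forall fun s => by simp only [Pi.add_apply]; ring))
  have hderiv : h' = deriv h := funext fun s => ((hh s).deriv).symm
  have hm : Measurable h' := hderiv ▸ measurable_deriv h
  have hTm : Measurable fun u => tailMass f (u ^ 2 / e + r) :=
    (measurable_tailMass f).comp (by fun_prop)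
  have hTi : Integrable fun u => (tailMass f (u ^ 2 / e + r)).toReal :=
    integrable_toReal_of_lintegral_ne_top hTm.aemeasurable hT
  have hTi' : Integrable fun u => h' u * (tailMass f (u ^ 2 / e + r)).toReal :=
    hTi.bdd_mul hm.aestronglyMeasurable (Eventually.of_forall fun s => by
      rw [Real.norm_eq_abs]; exact hM s)
  simp only [add_mul] at h2
  rw [integral_add hTi' (hTi.const_mul M)] at h2
  have h3 : ∫ s, 2 * s / e * f (s ^ 2 / e + r) * (h s + M * s) =
      (∫ s, 2 * s / e * f (s ^ 2 / e + r) * h s) +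
        ∫ s, 2 * s / e * f (s ^ 2 / e + r) * (M * s) := by
    rw [← integral_add hint hint2]
    congr 1 with s
    ring
  simp only [Pi.add_apply] at h2
  rw [h3, h1] at h2
  linarith

section Coordinate

variable {E Y : Type*} [MeasurableSpace E] [MeasurableSpace Y] {μ : Measure E} {ν : Measure Y}
  [SFinite ν] {f : ℝ → ℝ} {e m : ℝ} {Ψ : ℝ × Y ≃ᵐ E} {x ρ : E → ℝ} {r : Y → ℝ}

/-- The second moment of a coordinate of a spherical density is the total mass of its tail. -/
lemma lintegral_coord_sq_eq_lintegral_tailMass (hf : Measurable f) (he : 0 < e)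
    (hΨ : MeasurePreserving Ψ (volume.prod ν) μ) (hxm : Measurable x) (hρm : Measurable ρ)
    (hx : ∀ s y, x (Ψ (s, y)) = s) (hρ : ∀ s y, ρ (Ψ (s, y)) = (s - m) ^ 2 / e + r y) :
    ∫⁻ q, ENNReal.ofReal (2 * (x q - m) ^ 2 / e * f (ρ q)) ∂μ =
      ∫⁻ q, tailMass f (ρ q) ∂μ := by
  have hTm := measurable_tailMass f
  rw [← hΨ.lintegral_comp_emb Ψ.measurableEmbedding, ← hΨ.lintegral_comp_emb Ψ.measurableEmbedding,
    lintegral_prod_symm _ (by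
      have := Ψ.measurable
      exact Measurable.aemeasurable (by fun_prop)),
    lintegral_prod_symm _ (by
      have := Ψ.measurable
      exact Measurable.aemeasurable (by fun_prop))]
  congr 1 with y
  simp only [hx, hρ]
  rw [lintegral_sub_right_eq_self (fun s => ENNReal.ofReal (2 * s ^ 2 / e * f (s ^ 2 / e + r y))) m,
    lintegral_sub_right_eq_self (fun s => tailMass f (s ^ 2 / e + r y)) m,
    lintegral_sq_mul_eq_lintegral_tailMass hf he]

/-- Stein identity in one coordinate of a spherical density. -/
lemma stein_coord (hf : Measurable f) (hf0 : ∀ t, 0 ≤ f t) (he : 0 < e)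
    (hΨ : MeasurePreserving Ψ (volume.prod ν) μ) (hρm : Measurable ρ)
    (hx : ∀ s y, x (Ψ (s, y)) = s) (hρ : ∀ s y, ρ (Ψ (s, y)) = (s - m) ^ 2 / e + r y)
    (hT : ∫⁻ q, tailMass f (ρ q) ∂μ ≠ ∞) {h h' : E → ℝ} (hm : Measurable h')
    (hh : ∀ᵐ y ∂ν, ∀ s, HasDerivAt (fun s => h (Ψ (s, y))) (h' (Ψ (s, y))) s)
    {M : ℝ} (hM : ∀ q, |h' q| ≤ M)
    (hint : Integrable (fun q => 2 * (x q - m) / e * f (ρ q) * h q) μ) :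
    Integrable (fun q => h' q * (tailMass f (ρ q)).toReal) μ ∧
    ∫ q, 2 * (x q - m) / e * f (ρ q) * h q ∂μ = ∫ q, h' q * (tailMass f (ρ q)).toReal ∂μ := by
  have hTm : Measurable fun q => tailMass f (ρ q) := (measurable_tailMass f).comp hρm
  have hTi : Integrable (fun q => (tailMass f (ρ q)).toReal) μ :=
    integrable_toReal_of_lintegral_ne_top hTm.aemeasurable hT
  have hTi' : Integrable (fun q => h' q * (tailMass f (ρ q)).toReal) μ :=
    hTi.bdd_mul hm.aestronglyMeasurable (Eventually.of_forall fun s => by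
      rw [Real.norm_eq_abs]; exact hM s)
  refine ⟨hTi', ?_⟩
  have hintΨ := (hΨ.integrable_comp_emb Ψ.measurableEmbedding).2 hint
  have hTiΨ := (hΨ.integrable_comp_emb Ψ.measurableEmbedding).2 hTi'
  simp only [Function.comp_def] at hintΨ hTiΨ
  rw [← hΨ.integral_comp', ← hΨ.integral_comp', integral_prod_symm _ hintΨ,
    integral_prod_symm _ hTiΨ]
  have hTΨ : ∫⁻ y, (∫⁻ s, tailMass f (ρ (Ψ (s, y)))) ∂ν ≠ ∞ := by
    rwa [← lintegral_prod_symm (fun z => tailMass f (ρ (Ψ z)))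
      (hTm.comp Ψ.measurable).aemeasurable,
      hΨ.lintegral_comp_emb Ψ.measurableEmbedding (fun q => tailMass f (ρ q))]
  have hfin := ae_lt_top (Measurable.lintegral_prod_left' (f := fun z => tailMass f (ρ (Ψ z)))
    (hTm.comp Ψ.measurable)) hTΨ
  refine integral_congr_ae ?_
  filter_upwards [hfin, hh, hintΨ.prod_left_ae] with y hy hhy hiy
  simp only [hx, hρ] at hy hiy ⊢
  rw [lintegral_sub_right_eq_self (fun s => tailMass f (s ^ 2 / e + r y)) m] at hy
  have hiy' := hiy.comp_add_right m
  simp only [add_sub_cancel_right] at hiy'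
  have key := stein_of_deriv_bounded hf hf0 he (r y) hy.ne
    (h := fun s => h (Ψ (s + m, y))) (h' := fun s => h' (Ψ (s + m, y)))
    (fun s => (hhy (s + m)).comp_add_const s m) (fun s => hM _) hiy'
  have e1 := integral_add_right_eq_self (μ := volume)
    (fun s => 2 * (s - m) / e * f ((s - m) ^ 2 / e + r y) * h (Ψ (s, y))) m
  have e2 := integral_add_right_eq_self (μ := volume)
    (fun s => h' (Ψ (s, y)) * (tailMass f ((s - m) ^ 2 / e + r y)).toReal) m
  simp only [add_sub_cancel_right] at e1 e2
  rw [← e1, ← e2, key]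

end Coordinate

/-- Separate the `i`-th coordinate of the first factor. -/
noncomputable def fstCoordEquiv (p : ℕ) (Z : Type*) [MeasurableSpace Z] (i : Fin (p + 1)) :
    ℝ × ((Fin p → ℝ) × Z) ≃ᵐ (Fin (p + 1) → ℝ) × Z :=
  MeasurableEquiv.prodAssoc.symm.trans
    ((MeasurableEquiv.piFinSuccAbove (fun _ => ℝ) i).symm.prodCongr (MeasurableEquiv.refl Z))

lemma fstCoordEquiv_apply {p : ℕ} {Z : Type*} [MeasurableSpace Z] (i : Fin (p + 1)) (s : ℝ)
    (y : (Fin p → ℝ) × Z) : fstCoordEquiv p Z i (s, y) = (i.insertNth s y.1, y.2) := rfl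

lemma measurePreserving_fstCoordEquiv (p : ℕ) (Z : Type*) [MeasureSpace Z]
    [SFinite (volume : Measure Z)] (i : Fin (p + 1)) :
    MeasurePreserving (fstCoordEquiv p Z i) (volume.prod volume) volume := by
  have h : MeasurePreserving (MeasurableEquiv.prodAssoc (α := ℝ) (β := Fin p → ℝ) (γ := Z)) :=
    volume_preserving_prodAssoc
  exact (h.symm _).trans (((volume_preserving_piFinSuccAbove (fun _ => ℝ) i).symm _).prod (MeasurePreserving.id _))

/-- Separate the `k`-th coordinate of the second factor. -/
noncomputable def sndCoordEquiv (n : ℕ) (X : Type*) [MeasurableSpace X] (k : Fin (n + 1)) :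
    ℝ × ((Fin n → ℝ) × X) ≃ᵐ X × (Fin (n + 1) → ℝ) :=
  (fstCoordEquiv n X k).trans MeasurableEquiv.prodComm

lemma sndCoordEquiv_apply {n : ℕ} {X : Type*} [MeasurableSpace X] (k : Fin (n + 1)) (s : ℝ)
    (y : (Fin n → ℝ) × X) : sndCoordEquiv n X k (s, y) = (y.2, k.insertNth s y.1) := rfl

lemma measurePreserving_sndCoordEquiv (n : ℕ) (X : Type*) [MeasureSpace X]
    [SFinite (volume : Measure X)] (k : Fin (n + 1)) :
    MeasurePreserving (sndCoordEquiv n X k) (volume.prod volume) volume :=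
  (measurePreserving_fstCoordEquiv n X k).trans Measure.measurePreserving_swap

section Shrinkage

lemma hasDerivAt_mul_shrinkage {α a S Q' g : ℝ} (ha : 0 < a) (hg : 0 < g) (hS : 0 < S)
    (hQ : 0 ≤ Q') (s : ℝ) :
    HasDerivAt (fun s => s * (α * S / (a * S + (s ^ 2 / g + Q'))))
      (α * S / (a * S + (s ^ 2 / g + Q')) -
        2 * α * S * (s ^ 2 / g) / (a * S + (s ^ 2 / g + Q')) ^ 2) s := by
  have hN : a * S + (s ^ 2 / g + Q') ≠ 0 := by positivity
  have h1 : HasDerivAt (fun s : ℝ => a * S + (s ^ 2 / g + Q')) (2 * s / g) s := by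
    have := (((hasDerivAt_pow 2 s).div_const g).add_const Q').const_add (a * S)
    simpa using this
  have h2 := (hasDerivAt_id s).mul ((hasDerivAt_const s (α * S)).div h1 hN)
  refine (h2.congr_deriv ?_)
  simp only [id, Pi.div_apply]
  field_simp
  ring

lemma hasDerivAt_mul_penalty {α a S' Q : ℝ} (ha : 0 < a) (hS : 0 ≤ S') (hQ : 0 < Q) (s : ℝ) :
    HasDerivAt (fun s => s * (α ^ 2 * (s ^ 2 + S') * Q / (a * (s ^ 2 + S') + Q) ^ 2))
      (α ^ 2 * (s ^ 2 + S') * Q / (a * (s ^ 2 + S') + Q) ^ 2 +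
        2 * α ^ 2 * s ^ 2 * Q * (Q - a * (s ^ 2 + S')) / (a * (s ^ 2 + S') + Q) ^ 3) s := by
  have hN : a * (s ^ 2 + S') + Q ≠ 0 := by positivity
  have h0 : HasDerivAt (fun s : ℝ => s ^ 2 + S') (2 * s) s := by
    simpa using (hasDerivAt_pow 2 s).add_const S'
  have h1 := ((h0.const_mul a).add_const Q).pow 2
  have h2 := (hasDerivAt_id s).mul (((h0.const_mul (α ^ 2)).mul_const Q).div h1 (pow_ne_zero 2 hN))
  refine (h2.congr_deriv ?_)
  simp only [id, Pi.pow_apply, Pi.div_apply]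
  field_simp
  ring

variable {α a S Q : ℝ}

lemma div_le_inv_of_nonneg (ha : 0 < a) (hS : 0 ≤ S) (hQ : 0 ≤ Q) : S / (a * S + Q) ≤ a⁻¹ := by
  refine div_le_of_le_mul₀ (by positivity) (by positivity) ?_
  rw [mul_add, inv_mul_cancel_left₀ ha.ne']
  have : 0 ≤ a⁻¹ * Q := by positivity
  linarith

lemma abs_shrinkage_le (hα : 0 < α) (ha : 0 < a) (hS : 0 ≤ S) (hQ : 0 ≤ Q) :
    |α * S / (a * S + Q)| ≤ α * a⁻¹ := by
  rw [abs_of_nonneg (by positivity), mul_div_assoc]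
  exact mul_le_mul_of_nonneg_left (div_le_inv_of_nonneg ha hS hQ) hα.le

lemma abs_penalty_le (ha : 0 < a) (hS : 0 ≤ S) (hQ : 0 ≤ Q) :
    |α ^ 2 * S * Q / (a * S + Q) ^ 2| ≤ α ^ 2 * a⁻¹ := by
  rw [abs_of_nonneg (by positivity)]
  have h1 := div_le_inv_of_nonneg ha hS hQ
  have h2 : Q / (a * S + Q) ≤ 1 := div_le_one_of_le₀ (by nlinarith) (by positivity)
  calc α ^ 2 * S * Q / (a * S + Q) ^ 2 = α ^ 2 * (S / (a * S + Q) * (Q / (a * S + Q))) := by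
        generalize a * S + Q = N; ring
    _ ≤ α ^ 2 * (a⁻¹ * 1) := by gcongr
    _ = _ := by ring

lemma abs_shrinkage_deriv_le (hα : 0 < α) (ha : 0 < a) (hS : 0 ≤ S) {q : ℝ} (hq : 0 ≤ q)
    (hqQ : q ≤ Q) :
    |α * S / (a * S + Q) - 2 * α * S * q / (a * S + Q) ^ 2| ≤ 3 * α * a⁻¹ := by
  have hQ := hq.trans hqQ
  have h1 := div_le_inv_of_nonneg ha hS hQ
  have h2 : q / (a * S + Q) ≤ 1 :=
    div_le_one_of_le₀ (by nlinarith [mul_nonneg ha.le hS]) (by positivity)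
  have h3 : |2 * α * S * q / (a * S + Q) ^ 2| ≤ 2 * α * a⁻¹ := by
    rw [abs_of_nonneg (by positivity)]
    calc 2 * α * S * q / (a * S + Q) ^ 2
        = 2 * α * (S / (a * S + Q) * (q / (a * S + Q))) := by
          generalize a * S + Q = N; ring
      _ ≤ 2 * α * (a⁻¹ * 1) := by gcongr
      _ = _ := by ring
  calc _ ≤ |α * S / (a * S + Q)| + |2 * α * S * q / (a * S + Q) ^ 2| := abs_sub _ _
    _ ≤ _ := by linarith [abs_shrinkage_le hα ha hS hQ]

lemma abs_penalty_deriv_le (ha : 0 < a) (hQ : 0 ≤ Q) {u : ℝ} (hu : 0 ≤ u) (huS : u ≤ S) :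
    |α ^ 2 * S * Q / (a * S + Q) ^ 2 + 2 * α ^ 2 * u * Q * (Q - a * S) / (a * S + Q) ^ 3|
      ≤ 3 * α ^ 2 * a⁻¹ := by
  have hS := hu.trans huS
  have haS : 0 ≤ a * S := by positivity
  have h1 : u / (a * S + Q) ≤ a⁻¹ :=
    (div_le_div_of_nonneg_right huS (by positivity)).trans (div_le_inv_of_nonneg ha hS hQ)
  have h2 : Q / (a * S + Q) ≤ 1 := div_le_one_of_le₀ (by linarith) (by positivity)
  have h4 : |(Q - a * S) / (a * S + Q)| ≤ 1 := by
    rw [abs_div, abs_of_nonneg (show 0 ≤ a * S + Q by positivity)]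
    exact div_le_one_of_le₀ (abs_le.2 ⟨by linarith, by linarith⟩) (by positivity)
  have h3 : |2 * α ^ 2 * u * Q * (Q - a * S) / (a * S + Q) ^ 3| ≤ 2 * α ^ 2 * a⁻¹ := by
    rw [show 2 * α ^ 2 * u * Q * (Q - a * S) / (a * S + Q) ^ 3 =
      2 * α ^ 2 * (u / (a * S + Q) * (Q / (a * S + Q))) * ((Q - a * S) / (a * S + Q)) by
        generalize a * S + Q = N; ring,
      abs_mul, abs_of_nonneg (by positivity)]
    calc _ ≤ 2 * α ^ 2 * (a⁻¹ * 1) * 1 := by gcongr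
      _ = _ := by ring
  calc _ ≤ |α ^ 2 * S * Q / (a * S + Q) ^ 2| +
        |2 * α ^ 2 * u * Q * (Q - a * S) / (a * S + Q) ^ 3| := abs_add_le _ _
    _ ≤ _ := by linarith [abs_penalty_le (α := α) ha hS hQ]

/-- Pointwise negativity of the unbiased risk-difference estimate. -/
lemma risk_diff_pointwise (hα : 0 < α) (ha : 0 < a) (hS : 0 < S) {B R m : ℝ}
    (hR0 : 0 ≤ R) (hRQ : R ≤ Q) (hm : 0 ≤ m) (hαB : (m + 2) * α ≤ 2 * (B - 2)) :
    -(B * (α * S / (a * S + Q)) - 2 * α * S * R / (a * S + Q) ^ 2) +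
      1 / 2 * (m * (α ^ 2 * S * Q / (a * S + Q) ^ 2) +
        2 * α ^ 2 * S * Q * (Q - a * S) / (a * S + Q) ^ 3) ≤ 0 := by
  have hQ := hR0.trans hRQ
  have hN : 0 < a * S + Q := by positivity
  set N := a * S + Q with hNdef
  have haS : 0 < a * S := by positivity
  have key : -(B * (α * S / N) - 2 * α * S * R / N ^ 2) +
      1 / 2 * (m * (α ^ 2 * S * Q / N ^ 2) + 2 * α ^ 2 * S * Q * (Q - a * S) / N ^ 3) =
      α * S / N * (-B + 2 * (R / N) + 1 / 2 * (m * α * (Q / N)) +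
        α * (Q / N) * ((Q - a * S) / N)) := by
    field_simp
    ring
  rw [key]
  have h1 : Q / N ≤ 1 := div_le_one_of_le₀ (by linarith) hN.le
  have h2 : R / N ≤ 1 := div_le_one_of_le₀ (by linarith) hN.le
  have h3 : (Q - a * S) / N ≤ 1 := div_le_one_of_le₀ (by linarith) hN.le
  have h0 : 0 ≤ Q / N := by positivity
  have h4 : m * α * (Q / N) ≤ m * α := mul_le_of_le_one_right (by positivity) h1
  have h5 : α * (Q / N) * ((Q - a * S) / N) ≤ α := by
    calc α * (Q / N) * ((Q - a * S) / N) ≤ α * (Q / N) * 1 := by gcongr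
      _ ≤ α * 1 * 1 := by gcongr
      _ = α := by ring
  refine mul_nonpos_of_nonneg_of_nonpos (by positivity) ?_
  linarith

end Shrinkage

section Risk

variable {p n : ℕ}

lemma ae_sum_sq_pos (m : ℕ) {g : Fin (m + 1) → ℝ} (hg : ∀ i, 0 < g i) :
    ∀ᵐ z : Fin (m + 1) → ℝ, 0 < ∑ k, z k ^ 2 / g k := by
  filter_upwards [Measure.ae_ne volume (0 : Fin (m + 1) → ℝ)] with z hz
  obtain ⟨k, hk⟩ := Function.ne_iff.1 hz
  have hk' : z k ≠ 0 := hk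
  exact sum_pos' (fun i _ => div_nonneg (sq_nonneg _) (hg i).le)
    ⟨k, mem_univ k, div_pos (by positivity) (hg k)⟩

lemma integral_neg_sum_add_half_sum {E ι κ : Type*} [MeasurableSpace E] {μ : Measure E}
    [Fintype ι] [Fintype κ] {A : ι → E → ℝ} {B : κ → E → ℝ} {b : ι → ℝ}
    (hA : ∀ i, Integrable (A i) μ) (hB : ∀ k, Integrable (B k) μ) :
    ∫ q, (-(∑ i, b i * A i q) + 1 / 2 * ∑ k, B k q) ∂μ =
      -(∑ i, b i * ∫ q, A i q ∂μ) + 1 / 2 * ∑ k, ∫ q, B k q ∂μ := by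
  have h1 : Integrable (fun q => ∑ i, b i * A i q) μ :=
    integrable_finsetSum _ fun i _ => (hA i).const_mul _
  have h2 : Integrable (fun q => -(∑ i, b i * A i q)) μ := h1.neg
  have h3 : Integrable (fun q => ∑ k, B k q) μ := integrable_finsetSum _ fun k _ => hB k
  rw [integral_add h2 (h3.const_mul _), integral_neg, integral_const_mul,
    integral_finsetSum _ fun i _ => (hA i).const_mul _, integral_finsetSum _ fun k _ => hB k]
  simp only [integral_const_mul]

set_option maxHeartbeats 1600000 in
/-- Risk domination by the shrinkage estimator, up to the normalizing constant of the density,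
when the shrinkage factor is bounded. -/
lemma shrinkage_risk_le_of_pos {d c b w θ : Fin (p + 1) → ℝ} {κ α a σ : ℝ} {f : ℝ → ℝ}
    (hd : ∀ i, 0 < d i) (hc : ∀ i, 0 < c i) (hb0 : ∀ i, 0 ≤ b i) (hb1 : ∀ i, b i ≤ 1)
    (hκ : 0 ≤ κ) (hw : ∀ i, w i / c i = κ * (b i / d i))
    (hα : 0 < α) (hαB : ((n : ℝ) + 1 + 2) * α ≤ 2 * (∑ i, b i - 2)) (ha : 0 < a) (hσ : 0 < σ)
    (hf : Measurable f) (hf0 : ∀ t, 0 ≤ f t)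
    {ρ : (Fin (p + 1) → ℝ) × (Fin (n + 1) → ℝ) → ℝ}
    (hρ : ρ = fun q => ((∑ i, (q.1 i - θ i) ^ 2 / d i) + ∑ k, q.2 k ^ 2) / σ ^ 2)
    (hint : Integrable fun q => f (ρ q))
    (hint2 : ∀ i, Integrable fun q => (q.1 i - θ i) ^ 2 * f (ρ q)) :
    Integrable (fun q => (∑ i, w i * ((1 - α / (a +
      (∑ i', q.1 i' ^ 2 / (c i' * d i')) / (∑ k, q.2 k ^ 2)) / c i) * q.1 i - θ i) ^ 2) *
        f (ρ q)) ∧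
    ∫ q, (∑ i, w i * ((1 - α / (a +
      (∑ i', q.1 i' ^ 2 / (c i' * d i')) / (∑ k, q.2 k ^ 2)) / c i) * q.1 i - θ i) ^ 2) *
        f (ρ q) ≤
    ∫ q, (∑ i, w i * (q.1 i - θ i) ^ 2) * f (ρ q) := by
  set Q : (Fin (p + 1) → ℝ) × (Fin (n + 1) → ℝ) → ℝ := fun q => ∑ i', q.1 i' ^ 2 / (c i' * d i')
    with hQdef
  set S : (Fin (p + 1) → ℝ) × (Fin (n + 1) → ℝ) → ℝ := fun q => ∑ k, q.2 k ^ 2 with hSdef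
  have hcd : ∀ i, 0 < c i * d i := fun i => mul_pos (hc i) (hd i)
  have hQ0 : ∀ q, 0 ≤ Q q := fun q => sum_nonneg fun i _ => div_nonneg (sq_nonneg _) (hcd i).le
  have hS0 : ∀ q, 0 ≤ S q := fun q => sum_nonneg fun i _ => sq_nonneg _
  have hQm : Measurable Q := by fun_prop
  have hSm : Measurable S := by fun_prop
  have hρm : Measurable ρ := by rw [hρ]; fun_prop
  have hfm : Measurable fun q => f (ρ q) := hf.comp hρm
  have hQle : ∀ q i, q.1 i ^ 2 / (c i * d i) ≤ Q q := fun q i =>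
    single_le_sum (f := fun i => q.1 i ^ 2 / (c i * d i))
      (fun i _ => div_nonneg (sq_nonneg _) (hcd i).le) (mem_univ i)
  have hSle : ∀ q k, q.2 k ^ 2 ≤ S q := fun q k =>
    single_le_sum (f := fun k => q.2 k ^ 2) (fun i _ => sq_nonneg _) (mem_univ k)
  have hzpos : ∀ᵐ z : Fin (n + 1) → ℝ, 0 < ∑ k, z k ^ 2 := by
    simpa using ae_sum_sq_pos n (g := fun _ => 1) (fun _ => one_pos)
  have hxpos := ae_sum_sq_pos p hcd
  have hSpos : ∀ᵐ q, 0 < S q := Measure.quasiMeasurePreserving_snd.ae hzpos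
  set t := fun q => α * S q / (a * S q + Q q) with ht
  set G := fun q => α ^ 2 * S q * Q q / (a * S q + Q q) ^ 2 with hG
  have htm : Measurable t := by fun_prop
  have hGm : Measurable G := by fun_prop
  have htb : ∀ q, ‖t q‖ ≤ α * a⁻¹ := fun q => abs_shrinkage_le hα ha (hS0 q) (hQ0 q)
  have hGb : ∀ q, ‖G q‖ ≤ α ^ 2 * a⁻¹ := fun q => abs_penalty_le ha (hS0 q) (hQ0 q)
  -- the coordinates of the radial variable
  have hρx : ∀ i s (y : (Fin p → ℝ) × (Fin (n + 1) → ℝ)),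
      ρ (fstCoordEquiv p _ i (s, y)) = (s - θ i) ^ 2 / (d i * σ ^ 2) +
        ((∑ l, (y.1 l - θ (i.succAbove l)) ^ 2 / d (i.succAbove l)) + ∑ k, y.2 k ^ 2) / σ ^ 2 := by
    intro i s y
    have := (hd i).ne'
    simp only [hρ, fstCoordEquiv_apply, Fin.sum_univ_succAbove _ i, Fin.insertNth_apply_same,
      Fin.insertNth_apply_succAbove]
    field_simp
    ring
  have hρz : ∀ k s (y : (Fin n → ℝ) × (Fin (p + 1) → ℝ)),
      ρ (sndCoordEquiv n _ k (s, y)) = (s - 0) ^ 2 / σ ^ 2 +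
        ((∑ i, (y.2 i - θ i) ^ 2 / d i) + ∑ l, y.1 l ^ 2) / σ ^ 2 := by
    intro k s y
    simp only [hρ, sndCoordEquiv_apply, Fin.sum_univ_succAbove _ k, Fin.insertNth_apply_same,
      Fin.insertNth_apply_succAbove]
    ring
  have hxx : ∀ i s (y : (Fin p → ℝ) × (Fin (n + 1) → ℝ)),
      (fstCoordEquiv p _ i (s, y)).1 i = s := fun i s y => by simp [fstCoordEquiv_apply]
  have hzz : ∀ k s (y : (Fin n → ℝ) × (Fin (p + 1) → ℝ)),
      (sndCoordEquiv n _ k (s, y)).2 k = s := fun k s y => by simp [sndCoordEquiv_apply]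
  have hdσ : ∀ i, 0 < d i * σ ^ 2 := fun i => mul_pos (hd i) (by positivity)
  have hσ2 : 0 < σ ^ 2 := by positivity
  -- second moments
  have hT : ∫⁻ q, tailMass f (ρ q) ≠ ∞ := by
    rw [← lintegral_coord_sq_eq_lintegral_tailMass hf (hdσ 0)
      (measurePreserving_fstCoordEquiv p (Fin (n + 1) → ℝ) 0) (x := fun q => q.1 0)
      (by fun_prop) hρm (hxx 0) (hρx 0)]
    have h1 : Integrable fun q : (Fin (p + 1) → ℝ) × (Fin (n + 1) → ℝ) =>
        2 * (q.1 0 - θ 0) ^ 2 / (d 0 * σ ^ 2) * f (ρ q) := by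
      refine ((hint2 0).const_mul (2 / (d 0 * σ ^ 2))).congr (Eventually.of_forall fun q => ?_)
      simp only
      ring
    refine ((hasFiniteIntegral_iff_ofReal (Eventually.of_forall fun q => ?_)).1 h1.2).ne
    have := hd 0
    exact mul_nonneg (by positivity) (hf0 _)
  have hintz : ∀ k, Integrable fun q => q.2 k ^ 2 * f (ρ q) := by
    intro k
    have h1 := lintegral_coord_sq_eq_lintegral_tailMass hf hσ2
      (measurePreserving_sndCoordEquiv n (Fin (p + 1) → ℝ) k) (x := fun q => q.2 k)
      (by fun_prop) hρm (hzz k) (hρz k)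
    have h2 : Integrable fun q : (Fin (p + 1) → ℝ) × (Fin (n + 1) → ℝ) =>
        2 * (q.2 k - 0) ^ 2 / σ ^ 2 * f (ρ q) := by
      refine ⟨by fun_prop, ?_⟩
      rw [hasFiniteIntegral_iff_ofReal
        (Eventually.of_forall fun q => mul_nonneg (by positivity) (hf0 _)), h1]
      exact hT.lt_top
    refine (h2.const_mul (σ ^ 2 / 2)).congr (Eventually.of_forall fun q => ?_)
    simp only [sub_zero]
    field_simp
  have hint1 : ∀ i, Integrable fun q => (q.1 i - θ i) * f (ρ q) := by
    intro i
    refine (hint.add (hint2 i)).mono' (by fun_prop) (Eventually.of_forall fun q => ?_)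
    simp only [Pi.add_apply]
    rw [norm_mul, Real.norm_eq_abs, Real.norm_of_nonneg (hf0 _), ← one_add_mul]
    refine mul_le_mul_of_nonneg_right ?_ (hf0 _)
    rw [← sq_abs]
    nlinarith [sq_nonneg (|q.1 i - θ i| - 1), abs_nonneg (q.1 i - θ i)]
  have hintxc : ∀ i, Integrable fun q => q.1 i * (q.1 i - θ i) * f (ρ q) := by
    intro i
    refine ((hint2 i).add ((hint1 i).const_mul (θ i))).congr (Eventually.of_forall fun q => ?_)
    simp only [Pi.add_apply]
    ring
  have hintxx : ∀ i, Integrable fun q => q.1 i ^ 2 * f (ρ q) := by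
    intro i
    refine ((hint2 i).add (((hint1 i).const_mul (2 * θ i)).add (hint.const_mul (θ i ^ 2)))).congr
      (Eventually.of_forall fun q => ?_)
    simp only [Pi.add_apply]
    ring
  -- Stein identities
  set tx := fun (i : Fin (p + 1)) (q : (Fin (p + 1) → ℝ) × (Fin (n + 1) → ℝ)) =>
    α * S q / (a * S q + Q q) -
      2 * α * S q * (q.1 i ^ 2 / (c i * d i)) / (a * S q + Q q) ^ 2 with htx
  set gz := fun (k : Fin (n + 1)) (q : (Fin (p + 1) → ℝ) × (Fin (n + 1) → ℝ)) =>
    α ^ 2 * S q * Q q / (a * S q + Q q) ^ 2 +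
      2 * α ^ 2 * q.2 k ^ 2 * Q q * (Q q - a * S q) / (a * S q + Q q) ^ 3 with hgz
  set T := fun q => (tailMass f (ρ q)).toReal with hTdef
  set A := fun (i : Fin (p + 1)) (q : (Fin (p + 1) → ℝ) × (Fin (n + 1) → ℝ)) =>
    2 * (q.1 i - θ i) / (d i * σ ^ 2) * f (ρ q) * (q.1 i * t q) with hA
  set B := fun (k : Fin (n + 1)) (q : (Fin (p + 1) → ℝ) × (Fin (n + 1) → ℝ)) =>
    2 * (q.2 k - 0) / σ ^ 2 * f (ρ q) * (q.2 k * G q) with hB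
  have hAint : ∀ i, Integrable (A i) := by
    intro i
    refine (((hintxc i).bdd_mul htm.aestronglyMeasurable (Eventually.of_forall htb)).const_mul
      (2 / (d i * σ ^ 2))).congr (Eventually.of_forall fun q => ?_)
    simp only [hA]
    ring
  have hBint : ∀ k, Integrable (B k) := by
    intro k
    refine (((hintz k).bdd_mul hGm.aestronglyMeasurable (Eventually.of_forall hGb)).const_mul
      (2 / σ ^ 2)).congr (Eventually.of_forall fun q => ?_)
    simp only [hB]
    ring
  have hsteinx : ∀ i, Integrable (fun q => tx i q * T q) ∧ ∫ q, A i q = ∫ q, tx i q * T q := by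
    intro i
    refine stein_coord hf hf0 (hdσ i) (measurePreserving_fstCoordEquiv p (Fin (n + 1) → ℝ) i)
      (x := fun q => q.1 i) hρm (hxx i) (hρx i) hT (by fun_prop) ?_
      (fun q => abs_shrinkage_deriv_le hα ha (hS0 q) (div_nonneg (sq_nonneg _) (hcd i).le)
        (hQle q i)) (hAint i)
    have : ∀ᵐ y : (Fin p → ℝ) × (Fin (n + 1) → ℝ), 0 < ∑ k, y.2 k ^ 2 :=
      Measure.quasiMeasurePreserving_snd.ae hzpos
    filter_upwards [this] with y hy s
    have key := hasDerivAt_mul_shrinkage (α := α) ha (hcd i) hy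
      (Q' := ∑ l, y.1 l ^ 2 / (c (i.succAbove l) * d (i.succAbove l)))
      (sum_nonneg fun l _ => div_nonneg (sq_nonneg _) (hcd _).le) s
    simpa only [htx, ht, hQdef, hSdef, fstCoordEquiv_apply, Fin.sum_univ_succAbove _ i,
      Fin.insertNth_apply_same, Fin.insertNth_apply_succAbove] using key
  have hsteinz : ∀ k, Integrable (fun q => gz k q * T q) ∧ ∫ q, B k q = ∫ q, gz k q * T q := by
    intro k
    refine stein_coord hf hf0 hσ2 (measurePreserving_sndCoordEquiv n (Fin (p + 1) → ℝ) k)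
      (x := fun q => q.2 k) hρm (hzz k) (hρz k) hT (by fun_prop) ?_
      (fun q => abs_penalty_deriv_le ha (hQ0 q) (sq_nonneg _) (hSle q k)) (hBint k)
    have : ∀ᵐ y : (Fin n → ℝ) × (Fin (p + 1) → ℝ), 0 < ∑ i, y.2 i ^ 2 / (c i * d i) :=
      Measure.quasiMeasurePreserving_snd.ae hxpos
    filter_upwards [this] with y hy s
    have key := hasDerivAt_mul_penalty (α := α) ha
      (S' := ∑ l, y.1 l ^ 2) (sum_nonneg fun l _ => sq_nonneg _) hy s
    simpa only [hgz, hG, hQdef, hSdef, sndCoordEquiv_apply, Fin.sum_univ_succAbove _ k,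
      Fin.insertNth_apply_same, Fin.insertNth_apply_succAbove] using key
  -- the bound for the risk difference is nonpositive
  have hABle : ∫ q, (-(∑ i, b i * A i q) + 1 / 2 * ∑ k, B k q) ≤ 0 := by
    have e1 : ∫ q, (-(∑ i, b i * A i q) + 1 / 2 * ∑ k, B k q) =
        ∫ q, (-(∑ i, b i * (tx i q * T q)) + 1 / 2 * ∑ k, gz k q * T q) := by
      rw [integral_neg_sum_add_half_sum hAint hBint,
        integral_neg_sum_add_half_sum (fun i => (hsteinx i).1) (fun k => (hsteinz k).1)]
      simp only [fun i => (hsteinx i).2, fun k => (hsteinz k).2]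
    rw [e1]
    refine integral_nonpos_of_ae ?_
    filter_upwards [hSpos] with q hq
    have h1 := risk_diff_pointwise (Q := Q q) (R := ∑ i, b i * (q.1 i ^ 2 / (c i * d i)))
      (m := (n : ℝ) + 1) hα ha hq
      (sum_nonneg fun i _ => mul_nonneg (hb0 i) (div_nonneg (sq_nonneg _) (hcd i).le))
      (sum_le_sum fun i _ => mul_le_of_le_one_left (div_nonneg (sq_nonneg _) (hcd i).le) (hb1 i))
      (by positivity) hαB
    have h2 : -(∑ i, b i * (tx i q * T q)) + 1 / 2 * ∑ k, gz k q * T q =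
        (-((∑ i, b i) * (α * S q / (a * S q + Q q)) -
          2 * α * S q * (∑ i, b i * (q.1 i ^ 2 / (c i * d i))) / (a * S q + Q q) ^ 2) +
        1 / 2 * (((n : ℝ) + 1) * (α ^ 2 * S q * Q q / (a * S q + Q q) ^ 2) +
          2 * α ^ 2 * S q * Q q * (Q q - a * S q) / (a * S q + Q q) ^ 3)) * T q := by
      have h3 : ∑ i, b i * (tx i q * T q) = ((∑ i, b i) * (α * S q / (a * S q + Q q)) -
          2 * α * S q * (∑ i, b i * (q.1 i ^ 2 / (c i * d i))) / (a * S q + Q q) ^ 2) * T q := by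
        simp only [htx]
        generalize S q = S₀
        generalize Q q = Q₀
        rw [sum_mul, mul_sum, sum_div, ← sum_sub_distrib, sum_mul]
        refine sum_congr rfl fun i _ => ?_
        ring
      have h4 : ∑ k, gz k q * T q = (((n : ℝ) + 1) * (α ^ 2 * S q * Q q / (a * S q + Q q) ^ 2) +
          2 * α ^ 2 * S q * Q q * (Q q - a * S q) / (a * S q + Q q) ^ 3) * T q := by
        rw [← sum_mul]
        congr 1
        simp only [hgz]
        rw [sum_add_distrib, sum_const, card_univ, Fintype.card_fin, nsmul_eq_mul, Nat.cast_add,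
          Nat.cast_one]
        congr 1
        rw [← sum_div, ← sum_mul, ← sum_mul, ← mul_sum]
      rw [h3, h4]
      ring
    simp only [Pi.zero_apply]
    rw [h2]
    exact mul_nonpos_of_nonpos_of_nonneg h1 ENNReal.toReal_nonneg
  -- expansion of the loss
  set ls := fun q : (Fin (p + 1) → ℝ) × (Fin (n + 1) → ℝ) =>
    (∑ i, w i * (q.1 i - θ i) ^ 2) * f (ρ q) with hls
  set V := fun q : (Fin (p + 1) → ℝ) × (Fin (n + 1) → ℝ) =>
    κ * (∑ i, b i * (q.1 i ^ 2 / (c i * d i)) * t q ^ 2) * f (ρ q) with hV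
  have hlsint : Integrable ls := by
    simp only [hls, sum_mul, mul_assoc]
    exact integrable_finsetSum _ fun i _ => (hint2 i).const_mul _
  have hVint : Integrable V := by
    simp only [hV, mul_sum, sum_mul]
    refine integrable_finsetSum _ fun i _ => ?_
    refine (((hintxx i).bdd_mul (c := (α * a⁻¹) ^ 2) (f := fun q => t q ^ 2)
      (by fun_prop) (Eventually.of_forall fun q => ?_)).const_mul
      (κ * b i / (c i * d i))).congr (Eventually.of_forall fun q => ?_)
    · rw [norm_pow]
      exact pow_le_pow_left₀ (norm_nonneg _) (htb q) 2
    · simp only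
      ring
  have hAsum : Integrable fun q => κ * σ ^ 2 * -(∑ i, b i * A i q) :=
    (integrable_finsetSum _ fun i _ => (hAint i).const_mul _).neg.const_mul _
  have hBsum : Integrable fun q => κ * σ ^ 2 * (1 / 2 * ∑ k, B k q) :=
    ((integrable_finsetSum _ fun k _ => hBint k).const_mul _).const_mul _
  have hexp : (fun q => (∑ i, w i * ((1 - α / (a + Q q / S q) / c i) * q.1 i - θ i) ^ 2) *
      f (ρ q)) =ᵐ[volume] fun q => ls q + κ * σ ^ 2 * -(∑ i, b i * A i q) + V q := by
    filter_upwards [hSpos] with q hq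
    have hN : 0 < a * S q + Q q := add_pos_of_pos_of_nonneg (mul_pos ha hq) (hQ0 q)
    have htq : α / (a + Q q / S q) = t q := by
      simp only [ht]
      field_simp
    rw [htq]
    simp only [hls, hV, hA, sum_mul, mul_sum, ← sum_neg_distrib]
    rw [← sum_add_distrib, ← sum_add_distrib]
    refine sum_congr rfl fun i _ => ?_
    have hwi : w i = κ * (b i / d i) * c i := by rw [← hw i, div_mul_cancel₀ _ (hc i).ne']
    have := (hd i).ne'
    have := (hc i).ne'
    rw [hwi]
    field_simp
    ring
  have hVle : ∀ᵐ q, V q ≤ κ * σ ^ 2 * (1 / 2 * ∑ k, B k q) := by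
    filter_upwards [hSpos] with q hq
    have hN : 0 < a * S q + Q q := add_pos_of_pos_of_nonneg (mul_pos ha hq) (hQ0 q)
    have h1 : κ * σ ^ 2 * (1 / 2 * ∑ k, B k q) = κ * (Q q * t q ^ 2) * f (ρ q) := by
      have h2 : ∑ k, B k q = 2 / σ ^ 2 * (S q * G q) * f (ρ q) := by
        simp only [hSdef, sum_mul, mul_sum]
        refine sum_congr rfl fun k _ => ?_
        simp only [hB]
        ring
      rw [h2]
      simp only [hG, ht]
      field_simp
    rw [h1]
    simp only [hV]
    rw [← sum_mul]
    refine mul_le_mul_of_nonneg_right (mul_le_mul_of_nonneg_left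
      (mul_le_mul_of_nonneg_right ?_ (sq_nonneg _)) hκ) (hf0 _)
    exact sum_le_sum fun i _ =>
      mul_le_of_le_one_left (div_nonneg (sq_nonneg _) (hcd i).le) (hb1 i)
  refine ⟨((hlsint.add hAsum).add hVint).congr hexp.symm, ?_⟩
  rw [integral_congr_ae hexp]
  calc ∫ q, (ls q + κ * σ ^ 2 * -(∑ i, b i * A i q) + V q)
      ≤ ∫ q, (ls q + κ * σ ^ 2 * (-(∑ i, b i * A i q) + 1 / 2 * ∑ k, B k q)) := by
        refine integral_mono_ae ((hlsint.add hAsum).add hVint) ?_ ?_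
        · refine (hlsint.add (hAsum.add hBsum)).congr (Eventually.of_forall fun q => ?_)
          simp only [Pi.add_apply]
          ring
        · filter_upwards [hVle] with q hq
          linarith
    _ = (∫ q, ls q) + κ * σ ^ 2 * ∫ q, (-(∑ i, b i * A i q) + 1 / 2 * ∑ k, B k q) := by
        rw [integral_add hlsint, integral_const_mul]
        refine (hAsum.add hBsum).congr (Eventually.of_forall fun q => ?_)
        simp only [Pi.add_apply]
        ring
    _ ≤ ∫ q, ls q := by
        have : κ * σ ^ 2 * ∫ q, (-(∑ i, b i * A i q) + 1 / 2 * ∑ k, B k q) ≤ 0 :=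
          mul_nonpos_of_nonneg_of_nonpos (by positivity) hABle
        linarith


/-- Risk domination by the shrinkage estimator, up to the normalizing constant of the density. -/
lemma shrinkage_risk_le {d c b w θ : Fin (p + 1) → ℝ} {κ α a σ : ℝ} {f : ℝ → ℝ}
    (hd : ∀ i, 0 < d i) (hc : ∀ i, 0 < c i) (hb0 : ∀ i, 0 ≤ b i) (hb1 : ∀ i, b i ≤ 1)
    (hκ : 0 ≤ κ) (hw : ∀ i, w i / c i = κ * (b i / d i)) (hw0 : ∀ i, 0 ≤ w i)
    (hα : 0 < α) (hαB : ((n : ℝ) + 1 + 2) * α ≤ 2 * (∑ i, b i - 2)) (ha : 0 ≤ a) (hσ : 0 < σ)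
    (hf : Measurable f) (hf0 : ∀ t, 0 ≤ f t)
    {ρ : (Fin (p + 1) → ℝ) × (Fin (n + 1) → ℝ) → ℝ}
    (hρ : ρ = fun q => ((∑ i, (q.1 i - θ i) ^ 2 / d i) + ∑ k, q.2 k ^ 2) / σ ^ 2)
    (hint : Integrable fun q => f (ρ q))
    (hint2 : ∀ i, Integrable fun q => (q.1 i - θ i) ^ 2 * f (ρ q))
    (hintest : Integrable (fun q => (∑ i, w i * ((1 - α / (a +
      (∑ i', q.1 i' ^ 2 / (c i' * d i')) / (∑ k, q.2 k ^ 2)) / c i) * q.1 i - θ i) ^ 2) *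
        f (ρ q))) :
    ∫ q, (∑ i, w i * ((1 - α / (a +
      (∑ i', q.1 i' ^ 2 / (c i' * d i')) / (∑ k, q.2 k ^ 2)) / c i) * q.1 i - θ i) ^ 2) *
        f (ρ q) ≤
    ∫ q, (∑ i, w i * (q.1 i - θ i) ^ 2) * f (ρ q) := by
  set L : ℝ → (Fin (p + 1) → ℝ) × (Fin (n + 1) → ℝ) → ℝ := fun x q =>
    (∑ i, w i * ((1 - α / (x +
      (∑ i', q.1 i' ^ 2 / (c i' * d i')) / (∑ k, q.2 k ^ 2)) / c i) * q.1 i - θ i) ^ 2) *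
        f (ρ q) with hL
  set R := ∫ q : (Fin (p + 1) → ℝ) × (Fin (n + 1) → ℝ),
    (∑ i, w i * (q.1 i - θ i) ^ 2) * f (ρ q) with hR
  have hρm : Measurable ρ := by rw [hρ]; fun_prop
  have hfm : Measurable fun q => f (ρ q) := hf.comp hρm
  have hL0 : ∀ x q, 0 ≤ L x q := fun x q =>
    mul_nonneg (sum_nonneg fun i _ => mul_nonneg (hw0 i) (sq_nonneg _)) (hf0 _)
  have hLm : ∀ x, Measurable (L x) := fun x => by simp only [hL]; fun_prop
  have hR0 : 0 ≤ R := integral_nonneg fun q =>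
    mul_nonneg (sum_nonneg fun i _ => mul_nonneg (hw0 i) (sq_nonneg _)) (hf0 _)
  have hapos : ∀ m : ℕ, 0 < a + 1 / ((m : ℝ) + 1) := fun m => by positivity
  have hle : ∀ m : ℕ, ∫⁻ q, ENNReal.ofReal (L (a + 1 / ((m : ℝ) + 1)) q) ≤ ENNReal.ofReal R := by
    intro m
    have h := shrinkage_risk_le_of_pos hd hc hb0 hb1 hκ hw hα hαB (hapos m) hσ hf hf0 hρ hint hint2
    rw [← ofReal_integral_eq_lintegral_ofReal h.1 (Eventually.of_forall (hL0 _))]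
    exact ENNReal.ofReal_le_ofReal h.2
  have hxpos : ∀ᵐ q : (Fin (p + 1) → ℝ) × (Fin (n + 1) → ℝ), 0 < ∑ i, q.1 i ^ 2 / (c i * d i) :=
    Measure.quasiMeasurePreserving_fst.ae (ae_sum_sq_pos p fun i => mul_pos (hc i) (hd i))
  have hzpos : ∀ᵐ q : (Fin (p + 1) → ℝ) × (Fin (n + 1) → ℝ), 0 < ∑ k, q.2 k ^ 2 := by
    have : ∀ᵐ z : Fin (n + 1) → ℝ, 0 < ∑ k, z k ^ 2 := by
      simpa using ae_sum_sq_pos n (g := fun _ => 1) (fun _ => one_pos)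
    exact Measure.quasiMeasurePreserving_snd.ae this
  have hlim : ∀ᵐ q, Tendsto (fun m : ℕ => ENNReal.ofReal (L (a + 1 / ((m : ℝ) + 1)) q)) atTop
      (nhds (ENNReal.ofReal (L a q))) := by
    filter_upwards [hxpos, hzpos] with q hx hz
    have hne : a + (∑ i', q.1 i' ^ 2 / (c i' * d i')) / (∑ k, q.2 k ^ 2) ≠ 0 := by positivity
    have hcont : ContinuousAt (fun x => L x q) a := by
      simp only [hL]
      fun_prop (disch := assumption)
    have hseq : Tendsto (fun m : ℕ => a + 1 / ((m : ℝ) + 1)) atTop (nhds a) := by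
      simpa using tendsto_one_div_add_atTop_nhds_zero_nat.const_add a
    exact (ENNReal.continuous_ofReal.tendsto _).comp (hcont.tendsto.comp hseq)
  have hfatou : ∫⁻ q, ENNReal.ofReal (L a q) ≤ ENNReal.ofReal R := by
    calc ∫⁻ q, ENNReal.ofReal (L a q)
        = ∫⁻ q, liminf (fun m : ℕ => ENNReal.ofReal (L (a + 1 / ((m : ℝ) + 1)) q)) atTop := by
          refine lintegral_congr_ae ?_
          filter_upwards [hlim] with q hq
          exact hq.liminf_eq.symm
      _ ≤ liminf (fun m : ℕ => ∫⁻ q, ENNReal.ofReal (L (a + 1 / ((m : ℝ) + 1)) q)) atTop :=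
          lintegral_liminf_le fun m => (hLm _).ennreal_ofReal
      _ ≤ ENNReal.ofReal R := by
          refine liminf_le_of_frequently_le' (Frequently.of_forall hle)
  rw [← ofReal_integral_eq_lintegral_ofReal hintest (Eventually.of_forall (hL0 _))] at hfatou
  exact (ENNReal.ofReal_le_ofReal_iff hR0).1 hfatou

end Risk

section ConditionNumber

variable {p : ℕ} {d c : Fin (p + 1) → ℝ} {t : ℝ}

lemma shrunk_le_mul_shrunk (hd : ∀ i, 0 < d i) (hd_mono : Antitone d) (hc : ∀ i, 0 < c i)
    (hc_mono : Monotone c) (ht0 : 0 ≤ t) (ht : ∀ i, t ≤ c i)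
    (hv : ∀ i k, k < i → t * (c i * d 0 * d k - c k * d i * d (Fin.last p)) ≤
      c i * c k * (d 0 * d k - d i * d (Fin.last p))) (i k : Fin (p + 1)) :
    d i * (1 - t / c i) ≤ d 0 / d (Fin.last p) * (d k * (1 - t / c k)) := by
  have hp := hd (Fin.last p)
  rw [div_mul_eq_mul_div, le_div_iff₀ hp]
  have hnn : ∀ l, 0 ≤ 1 - t / c l := fun l => by
    have := (div_le_one (hc l)).2 (ht l)
    linarith
  rcases lt_or_ge k i with h | h
  · have h1 := hv i k h
    have hi := hc i
    have hk := hc k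
    have h2 : d 0 * (d k * (1 - t / c k)) - d i * (1 - t / c i) * d (Fin.last p) =
        (c i * c k * (d 0 * d k - d i * d (Fin.last p)) -
          t * (c i * d 0 * d k - c k * d i * d (Fin.last p))) / (c i * c k) := by
      field_simp
      ring
    have h3 := div_nonneg (sub_nonneg.2 h1) (mul_pos hi hk).le
    linarith
  · have h1 : t / c k ≤ t / c i := div_le_div_of_nonneg_left ht0 (hc i) (hc_mono h)
    have h0 : d i ≤ d 0 := hd_mono (Fin.zero_le i)
    have hl : d (Fin.last p) ≤ d k := hd_mono (Fin.le_last k)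
    calc d i * (1 - t / c i) * d (Fin.last p) ≤ d 0 * (1 - t / c k) * d k := by
          have h4 : 1 - t / c i ≤ 1 - t / c k := by linarith
          have := hnn i
          have := hnn k
          have := hd 0
          gcongr
      _ = _ := by ring

/-- The shrinkage does not increase the ratio of the extreme diagonal entries. -/
lemma sup_div_inf_shrunk_le (hd : ∀ i, 0 < d i) (hd_mono : Antitone d) (hc : ∀ i, 0 < c i)
    (hc_mono : Monotone c) (ht0 : 0 ≤ t) (ht : ∀ i, t ≤ c i)
    (hv : ∀ i k, k < i → t * (c i * d 0 * d k - c k * d i * d (Fin.last p)) ≤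
      c i * c k * (d 0 * d k - d i * d (Fin.last p))) (hne : (univ : Finset (Fin (p + 1))).Nonempty) :
    univ.sup' hne (fun i => d i * (1 - t / c i)) / univ.inf' hne (fun i => d i * (1 - t / c i)) ≤
      d 0 / d (Fin.last p) := by
  obtain ⟨k, -, hk⟩ := exists_mem_eq_inf' hne (fun i => d i * (1 - t / c i))
  have hkn : 0 ≤ d k * (1 - t / c k) := by
    have := (div_le_one (hc k)).2 (ht k)
    exact mul_nonneg (hd k).le (by linarith)
  rw [hk]
  refine div_le_of_le_mul₀ hkn (div_nonneg (hd _).le (hd _).le) (sup'_le _ _ fun i _ => ?_)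
  exact shrunk_le_mul_shrunk hd hd_mono hc hc_mono ht0 ht hv i k

/-- The bound `t ≤ v₊` in division-free form, together with `t ≤ c i`, from the bound on `γ`. -/
lemma shrinkage_factor_bounds {α γ w : ℝ} (hα : 0 < α) (hw : 0 < w) (hd : ∀ i, 0 < d i)
    (hd_mono : Antitone d) (hc : ∀ i, 1 ≤ c i) (hc0 : c 0 = 1) (hc_mono : Monotone c)
    (hlt : d (Fin.last p) < d 0)
    (hγv : ∀ i k, k < i → α / ((α + 1) * (c i * c k * (d 0 * d k - d i * d (Fin.last p)) /
      (c i * d 0 * d k - c k * d i * d (Fin.last p)))) ≤ γ) :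
    (∀ i, α / (γ * (α + 1) + w) ≤ c i) ∧
    ∀ i k, k < i → α / (γ * (α + 1) + w) * (c i * d 0 * d k - c k * d i * d (Fin.last p)) ≤
      c i * c k * (d 0 * d k - d i * d (Fin.last p)) := by
  have hcp : ∀ i, 0 < c i := fun i => one_pos.trans_le (hc i)
  have key : ∀ i k, k < i → α / (γ * (α + 1) + w) *
      (c i * d 0 * d k - c k * d i * d (Fin.last p)) ≤
        c i * c k * (d 0 * d k - d i * d (Fin.last p)) := by
    intro i k hki
    have hdi := hd i
    have hdk := hd k
    have hdp := hd (Fin.last p)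
    have hik : d i ≤ d k := hd_mono hki.le
    have hnum : 0 < d 0 * d k - d i * d (Fin.last p) := by
      have h1 : d i * d (Fin.last p) ≤ d k * d (Fin.last p) := by gcongr
      have h2 : d k * d (Fin.last p) < d k * d 0 := by gcongr
      linarith [mul_comm (d k) (d 0)]
    have hden : 0 < c i * d 0 * d k - c k * d i * d (Fin.last p) := by
      have h1 : c k * (d i * d (Fin.last p)) ≤ c i * (d i * d (Fin.last p)) := by
        have := hc_mono hki.le
        gcongr
      have h2 := mul_pos (hcp i) hnum
      nlinarith
    have hi := hcp i
    have hk := hcp k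
    have h := hγv i k hki
    set v := c i * c k * (d 0 * d k - d i * d (Fin.last p)) /
      (c i * d 0 * d k - c k * d i * d (Fin.last p)) with hv
    have hvpos : 0 < v := by positivity
    have hγ : 0 < γ := lt_of_lt_of_le (by positivity) h
    rw [div_le_iff₀ (by positivity)] at h
    have htv : α / (γ * (α + 1) + w) ≤ v := by
      rw [div_le_iff₀ (by positivity)]
      nlinarith [mul_pos hw hvpos]
    rwa [hv, le_div_iff₀ hden] at htv
  refine ⟨fun i => ?_, key⟩
  have hp0 : (0 : Fin (p + 1)) < Fin.last p := by
    refine lt_of_le_of_ne (Fin.zero_le _) fun h => ?_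
    rw [← h] at hlt
    exact lt_irrefl _ hlt
  have h := key (Fin.last p) 0 hp0
  rw [hc0] at h
  have h0 := hd 0
  have hl := hd (Fin.last p)
  have hcl := hc (Fin.last p)
  have hsq : d (Fin.last p) * d (Fin.last p) < d 0 * d 0 := by gcongr
  have hpos : 0 < c (Fin.last p) * d 0 * d 0 - 1 * d (Fin.last p) * d (Fin.last p) := by
    nlinarith [mul_pos h0 h0]
  have h1 : c (Fin.last p) * 1 * (d 0 * d 0 - d (Fin.last p) * d (Fin.last p)) ≤
      1 * (c (Fin.last p) * d 0 * d 0 - 1 * d (Fin.last p) * d (Fin.last p)) := by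
    nlinarith [mul_pos hl hl]
  exact (le_of_mul_le_mul_right (h.trans h1) hpos).trans (hc i)

end ConditionNumber

lemma weight_div_exponent {x y η : ℝ} (j : ℕ) (hx : 0 < x) (hy : 0 < y) :
    (x ^ j)⁻¹ / (y / x) ^ ((j : ℝ) - 1 + η) = y / y ^ j * ((x / y) ^ η / x) := by
  have h1 : (y / x) ^ ((j : ℝ) - 1 + η) = (y / x) ^ j / (y / x) * (y / x) ^ η := by
    rw [Real.rpow_add (by positivity), Real.rpow_sub (by positivity), Real.rpow_natCast,
      Real.rpow_one]
  have h2 : (x / y) ^ η = ((y / x) ^ η)⁻¹ := by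
    rw [← Real.inv_rpow (by positivity), inv_div]
  have h3 : 0 < (y / x) ^ η := by positivity
  rw [h1, h2, div_pow]
  field_simp

/-- Corollary 4.4(i): under the setting of Theorem 4.1 (`p ≥ 3`,
`∑ (d_i/d₁)^{1−j} > 2`, `c_i = (d₁/d_i)^{j−1+η_**}`,
`u₊ = (2/(n+2))(∑ (d_i/d₁)^{η_**} − 2)`,
`v₊ = min_{j'<i} c_i c_{j'}(d₁d_{j'} − d_i d_p)/(c_i d₁ d_{j'} − c_{j'} d_i d_p)`),
the simple (generalized Bayes, under normality) estimator
`θ̂_SB = (I − (α/(γ(α+1)+W))C^{-1})X` with `0 < α ≤ u₊` and `γ ≥ α/((α+1)v₊)`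
is minimax under `L_j` and does not increase the condition number. -/
theorem stmt_19
    (p n : ℕ) (hp : 3 ≤ p) (hn : 0 < n) (j : ℕ)
    (d c : Fin p → ℝ)
    (hd_pos : ∀ i, 0 < d i)
    (hd_mono : ∀ i k : Fin p, i ≤ k → d k ≤ d i)
    (hsum : 2 < ∑ i, (d i / d ⟨0, by omega⟩) ^ ((1 : ℝ) - j))
    (η : ℝ)
    (hη : (d ⟨1, by omega⟩ < d ⟨0, by omega⟩ ∧
        ∃ ηs : ℝ, 0 < ηs ∧ (∑ i, (d i / d ⟨0, by omega⟩) ^ ηs) = 2 ∧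
          max 0 (1 - (j : ℝ)) < η ∧ η < ηs) ∨
      (d ⟨1, by omega⟩ = d ⟨0, by omega⟩ ∧ max (1 - (j : ℝ)) 0 < η))
    (hc : ∀ i, c i = (d ⟨0, by omega⟩ / d i) ^ ((j : ℝ) - 1 + η))
    (f : ℝ → ℝ) (hf_nonneg : ∀ t, 0 ≤ f t) (hf_meas : Measurable f)
    (α γ : ℝ) (hα : 0 < α)
    -- `α ≤ u₊`
    (hαu : α ≤ 2 / ((n : ℝ) + 2) * ((∑ i, (d i / d ⟨0, by omega⟩) ^ η) - 2))
    -- `γ ≥ α/((α+1)v₊)`, i.e. `γ ≥ α/((α+1)·(each term of the min))`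
    (hγv : ∀ i k : Fin p, k < i →
      α / ((α + 1) *
        (c i * c k * (d ⟨0, by omega⟩ * d k - d i * d ⟨p - 1, by omega⟩) /
          (c i * d ⟨0, by omega⟩ * d k - c k * d i * d ⟨p - 1, by omega⟩))) ≤ γ)
    (θ : Fin p → ℝ) (σ : ℝ) (hσ : 0 < σ)
    (dens : ((Fin p → ℝ) × (Fin n → ℝ)) → ℝ)
    (hdens : dens = fun q => (∏ i, (d i) ^ (-(1:ℝ)/2)) * σ ^ (-(p : ℝ) - n) *
      f (((∑ i, (q.1 i - θ i) ^ 2 / d i) + ∑ k, (q.2 k) ^ 2) / σ ^ 2))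
    (hnorm : ∫ q, dens q = 1)
    (est : ((Fin p → ℝ) × (Fin n → ℝ)) → Fin p → ℝ)
    (hest : est = fun q i =>
      (1 - α / (γ * (α + 1) +
          (∑ i', (q.1 i') ^ 2 / (c i' * d i')) / (∑ k, (q.2 k) ^ 2)) / c i) * q.1 i)
    (h_int_est : Integrable (fun q => (∑ i, (est q i - θ i) ^ 2 / d i ^ j) / σ ^ 2 * dens q))
    (h_int_ls : Integrable (fun q => (∑ i, (q.1 i - θ i) ^ 2 / d i ^ j) / σ ^ 2 * dens q)) :
    -- (a) minimaxity under `L_j`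
    (∫ q, (∑ i, (est q i - θ i) ^ 2 / d i ^ j) / σ ^ 2 * dens q ≤
      ∫ q, (∑ i, (q.1 i - θ i) ^ 2 / d i ^ j) / σ ^ 2 * dens q) ∧
    -- (b) the condition number is not increased, for every realized shrinkage factor
    -- `t = α/(γ(α+1)+w)`
    (∀ w > (0:ℝ),
      (univ.sup' (univ_nonempty_iff.mpr ⟨⟨0, by omega⟩⟩)
          (fun i => d i * (1 - α / (γ * (α + 1) + w) / c i))) /
        (univ.inf' (univ_nonempty_iff.mpr ⟨⟨0, by omega⟩⟩)
          (fun i => d i * (1 - α / (γ * (α + 1) + w) / c i)))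
        ≤ d ⟨0, by omega⟩ / d ⟨p - 1, by omega⟩) := by
  obtain ⟨p, rfl⟩ : ∃ p', p = p' + 1 := ⟨p - 1, by omega⟩
  obtain ⟨n, rfl⟩ : ∃ n', n = n' + 1 := ⟨n - 1, by omega⟩
  change ∀ i, c i = (d 0 / d i) ^ ((j : ℝ) - 1 + η) at hc
  change α ≤ 2 / (((n + 1 : ℕ) : ℝ) + 2) * ((∑ i, (d i / d 0) ^ η) - 2) at hαu
  change ∀ i k, k < i → α / ((α + 1) * (c i * c k * (d 0 * d k - d i * d (Fin.last p)) /
      (c i * d 0 * d k - c k * d i * d (Fin.last p)))) ≤ γ at hγv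
  have hmono : Antitone d := fun i k => hd_mono i k
  have hη0 : 0 < η ∧ 0 < (j : ℝ) - 1 + η := by
    rcases hη with ⟨-, ηs, -, -, h, -⟩ | ⟨-, h⟩ <;> rw [max_lt_iff] at h <;>
      constructor <;> linarith
  have hd0 : ∀ i, d i ≤ d 0 := fun i => hmono (Fin.zero_le i)
  have hc1 : ∀ i, 1 ≤ c i := fun i => by
    rw [hc]
    exact Real.one_le_rpow ((one_le_div (hd_pos i)).2 (hd0 i)) hη0.2.le
  have hcpos : ∀ i, 0 < c i := fun i => one_pos.trans_le (hc1 i)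
  have hc0 : c 0 = 1 := by rw [hc, div_self (hd_pos 0).ne', Real.one_rpow]
  have hc_mono : Monotone c := fun i k hik => by
    rw [hc, hc]
    exact Real.rpow_le_rpow (div_pos (hd_pos 0) (hd_pos i)).le
      (div_le_div_of_nonneg_left (hd_pos 0).le (hd_pos k) (hmono hik)) hη0.2.le
  have hγ : 0 ≤ γ := by
    have h01 : (0 : Fin (p + 1)) < Fin.last p := by
      rw [Fin.lt_def, Fin.val_zero, Fin.val_last]
      omega
    refine le_trans ?_ (hγv (Fin.last p) 0 h01)
    have h0 := hd_pos 0
    have hl := hd_pos (Fin.last p)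
    have hsq : d (Fin.last p) * d (Fin.last p) ≤ d 0 * d 0 :=
      mul_le_mul (hd0 _) (hd0 _) hl.le h0.le
    have hcl := hc1 (Fin.last p)
    rw [hc0]
    have hden : 0 ≤ c (Fin.last p) * d 0 * d 0 - 1 * d (Fin.last p) * d (Fin.last p) := by
      nlinarith [mul_pos h0 h0]
    have hnum := sub_nonneg.2 hsq
    positivity
  refine ⟨?_, fun w hw => ?_⟩
  · set K := (∏ i, (d i) ^ (-(1:ℝ)/2)) * σ ^ (-((p + 1 : ℕ) : ℝ) - ((n + 1 : ℕ) : ℝ)) with hK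
    have hKpos : 0 < K :=
      mul_pos (prod_pos fun i _ => Real.rpow_pos_of_pos (hd_pos i) _) (Real.rpow_pos_of_pos hσ _)
    set ρ : (Fin (p + 1) → ℝ) × (Fin (n + 1) → ℝ) → ℝ :=
      fun q => ((∑ i, (q.1 i - θ i) ^ 2 / d i) + ∑ k, q.2 k ^ 2) / σ ^ 2 with hρ
    have hloss : ∀ (g : (Fin (p + 1) → ℝ) × (Fin (n + 1) → ℝ) → Fin (p + 1) → ℝ),
        (fun q => (∑ i, (g q i - θ i) ^ 2 / d i ^ j) / σ ^ 2 * dens q) =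
          fun q => K / σ ^ 2 * ((∑ i, (d i ^ j)⁻¹ * (g q i - θ i) ^ 2) * f (ρ q)) := by
      intro g
      funext q
      simp only [hdens, div_eq_inv_mul (_ ^ 2) (d _ ^ j)]
      ring
    have hKσ : IsUnit (K / σ ^ 2) := (div_pos hKpos (pow_pos hσ 2)).ne'.isUnit
    have hint : Integrable fun q => f (ρ q) := by
      have h := integrable_of_integral_eq_one hnorm
      rw [hdens] at h
      exact (integrable_const_mul_iff hKpos.ne'.isUnit _).1 h
    rw [hloss fun q => q.1, integrable_const_mul_iff hKσ] at h_int_ls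
    rw [hloss est, integrable_const_mul_iff hKσ] at h_int_est
    rw [hloss fun q => q.1, hloss est, integral_const_mul, integral_const_mul]
    have hρm : Measurable ρ := by fun_prop
    have hfm : Measurable fun q => f (ρ q) := hf_meas.comp hρm
    have hint2 : ∀ i, Integrable fun q => (q.1 i - θ i) ^ 2 * f (ρ q) := by
      intro i
      refine (h_int_ls.const_mul (d i ^ j)).mono' (by fun_prop) (Eventually.of_forall fun q => ?_)
      rw [Real.norm_of_nonneg (mul_nonneg (sq_nonneg _) (hf_nonneg _)), ← mul_assoc]
      refine mul_le_mul_of_nonneg_right ?_ (hf_nonneg _)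
      have hdj := pow_pos (hd_pos i) j
      have h := single_le_sum (f := fun i => (d i ^ j)⁻¹ * (q.1 i - θ i) ^ 2)
        (fun k _ => mul_nonneg (inv_nonneg.2 (pow_pos (hd_pos k) j).le) (sq_nonneg _)) (mem_univ i)
      calc (q.1 i - θ i) ^ 2 = d i ^ j * ((d i ^ j)⁻¹ * (q.1 i - θ i) ^ 2) := by field_simp
        _ ≤ _ := mul_le_mul_of_nonneg_left h hdj.le
    have hαB : ((n : ℝ) + 1 + 2) * α ≤ 2 * (∑ i, (d i / d 0) ^ η - 2) := by
      push_cast at hαu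
      rw [div_mul_eq_mul_div, le_div_iff₀ (by positivity)] at hαu
      linarith
    have hquot : ∀ i, 0 ≤ d i / d 0 := fun i => (div_pos (hd_pos i) (hd_pos 0)).le
    refine mul_le_mul_of_nonneg_left ?_ (div_pos hKpos (pow_pos hσ 2)).le
    rw [hest] at h_int_est ⊢
    exact shrinkage_risk_le (b := fun i => (d i / d 0) ^ η) (κ := d 0 / d 0 ^ j) hd_pos hcpos
      (fun i => Real.rpow_nonneg (hquot i) η)
      (fun i => Real.rpow_le_one (hquot i) ((div_le_one (hd_pos 0)).2 (hd0 i)) hη0.1.le)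
      (div_pos (hd_pos 0) (pow_pos (hd_pos 0) j)).le
      (fun i => by rw [hc]; exact weight_div_exponent j (hd_pos i) (hd_pos 0))
      (fun i => inv_nonneg.2 (pow_pos (hd_pos i) j).le) hα hαB (by positivity) hσ hf_meas
      hf_nonneg hρ hint hint2 h_int_est
  · rcases (hd0 (Fin.last p)).lt_or_eq with hlt | heq
    · obtain ⟨ht, hv⟩ := shrinkage_factor_bounds hα hw hd_pos hmono hc1 hc0 hc_mono hlt hγv
      exact sup_div_inf_shrunk_le hd_pos hmono hcpos hc_mono (by positivity) ht hv _
    · have hconst : ∀ i, d i = d 0 := fun i =>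
        (hd0 i).antisymm (heq.symm.trans_le (hmono (Fin.le_last i)))
      have hfun : (fun i => d i * (1 - α / (γ * (α + 1) + w) / c i)) =
          fun _ => d 0 * (1 - α / (γ * (α + 1) + w) / c 0) := by
        funext i
        rw [hc i, hconst i, ← hc 0]
      rw [hfun, sup'_const, inf'_const]
      change _ ≤ d 0 / d (Fin.last p)
      rw [heq, div_self (hd_pos 0).ne']
      exact div_self_le_one _
end
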